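/- arXiv:1612.05232 — 4 statements merged into one kernel-verified Lean document; each statement's English description precedes it below -/
import Mathlib

section
/- For all positive integers m and k, t*({2m}_k) = ((−1)^{mk} / (2mk)!) · (π/2)^{2mk} · Σ_{n_1 + ... + n_m = mk, n_j ≥ 0} (2mk)!/((2n_1)!···(2n_m)!) · Π_{j=1}^{m} e^{(2πi/m)(j−1)n_j} E_{2n_j}, where the sum is over all m-tuples of nonnegative integers n_1,...,n_m summing to mk. -/
open scoped Real

/-- Multiple t-star value: sum over weakly decreasing tuples of odd positive
integers. -/
noncomputable def multTStar {k : ℕ} (a : Fin k → ℕ) : ℝ :=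
  ∑' n : {f : Fin k → ℕ // Antitone f ∧ ∀ i, Odd (f i)},
    ∏ i, 1 / ((n.1 i : ℝ) ^ (a i))


open Finset in
noncomputable def hs {R : Type*} [CommRing R] (x : ℕ → R) (N k : ℕ) : R :=
  open Classical in
  ∑ f ∈ (Fintype.piFinset fun _ : Fin k => Finset.range N).filter (fun f => Antitone f), ∏ i, x (f i)

lemma hs_zero_right {R : Type*} [CommRing R] (x : ℕ → R) (N : ℕ) : hs x N 0 = 1 := by
  classical
  unfold hs
  rw [Finset.sum_eq_single_of_mem Fin.elim0]
  · simp
  · rw [Finset.mem_filter]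
    exact ⟨Fintype.mem_piFinset.2 fun i => i.elim0, fun i => i.elim0⟩
  · intro b _ hb; exact absurd (Subsingleton.elim _ _) hb

lemma hs_zero_left {R : Type*} [CommRing R] (x : ℕ → R) (k : ℕ) : hs x 0 (k+1) = 0 := by
  classical
  unfold hs
  apply Finset.sum_eq_zero
  intro f hf
  simp only [Finset.mem_filter, Fintype.mem_piFinset] at hf
  have := hf.1 0
  simp at this

lemma hs_succ {R : Type*} [CommRing R] (x : ℕ → R) (N k : ℕ) :
    hs x (N+1) (k+1) = hs x N (k+1) + x N * hs x (N+1) k := by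
  classical
  have key : (Fintype.piFinset fun _ : Fin (k+1) => Finset.range (N+1)).filter (fun f => Antitone f)
      = (Fintype.piFinset fun _ : Fin (k+1) => Finset.range N).filter (fun f => Antitone f) ∪
        ((Fintype.piFinset fun _ : Fin k => Finset.range (N+1)).filter (fun f => Antitone f)).image
          (fun g => (Fin.cons N g : Fin (k+1) → ℕ)) := by
    ext f
    simp only [Finset.mem_union, Finset.mem_image, Finset.mem_filter, Fintype.mem_piFinset,
      Finset.mem_range]
    constructor
    · rintro ⟨h1, h2⟩
      by_cases h0 : f 0 < N
      · left
        exact ⟨fun i => (h2 (Fin.zero_le i)).trans_lt h0, h2⟩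
      · right
        have h0' : f 0 = N := by have := h1 0; omega
        refine ⟨Fin.tail f, ⟨fun i => h1 _, fun i j hij => h2 (Fin.succ_le_succ_iff.2 hij)⟩, ?_⟩
        rw [← h0']; exact Fin.cons_self_tail f
    · rintro (⟨h1, h2⟩ | ⟨g, ⟨h1, h2⟩, rfl⟩)
      · exact ⟨fun i => (h1 i).trans (Nat.lt_succ_self _), h2⟩
      · constructor
        · intro i
          refine Fin.cases ?_ (fun i => ?_) i
          · simp
          · simpa using h1 i
        · intro i j
          refine Fin.cases ?_ (fun i => ?_) i
          · refine Fin.cases ?_ (fun j => ?_) j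
            · simp
            · intro _; have := h1 j; simp; omega
          · refine Fin.cases ?_ (fun j => ?_) j
            · intro h; simp at h
            · intro h; simpa using h2 (Fin.succ_le_succ_iff.1 h)
  unfold hs
  rw [key, Finset.sum_union, Finset.sum_image, Finset.mul_sum]
  · congr 1
    apply Finset.sum_congr rfl
    intro g _
    rw [Fin.prod_univ_succ]
    simp
  · intro a _ b _ h
    exact Fin.cons_right_injective _ h
  · rw [Finset.disjoint_left]
    intro f hf hf'
    simp only [Finset.mem_image, Finset.mem_filter, Fintype.mem_piFinset,
      Finset.mem_range] at hf hf'
    obtain ⟨g, _, rfl⟩ := hf'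
    have := hf.1 0
    simp at this

open PowerSeries in
lemma hs_gen {R : Type*} [CommRing R] (x : ℕ → R) (N : ℕ) :
    (PowerSeries.mk (hs x N)) * ∏ i ∈ Finset.range N, (1 - C (x i) * X) = 1 := by
  induction N with
  | zero =>
    ext n
    cases n with
    | zero => simp [hs_zero_right]
    | succ n => simp [hs_zero_left, PowerSeries.coeff_one]
  | succ N ih =>
    rw [Finset.prod_range_succ, mul_comm (∏ i ∈ _, _), ← mul_assoc]
    convert ih using 2
    ext n
    rw [mul_sub, mul_one, ← mul_assoc]
    cases n with
    | zero => simp [hs_zero_right]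
    | succ n =>
      rw [map_sub, PowerSeries.coeff_succ_mul_X, PowerSeries.coeff_mul_C]
      simp [hs_succ]; ring

lemma rou_prod {m : ℕ} (hm : 1 ≤ m) {R : Type*} [CommRing R] [IsDomain R] (ω : R)
    (h : IsPrimitiveRoot ω m) (z : R) : ∏ j : Fin m, (1 - ω ^ (j : ℕ) * z) = 1 - z ^ m := by
  classical
  have := h.pow_sub_pow_eq_prod_sub_mul 1 z hm
  rw [one_pow] at this
  rw [this]
  refine Finset.prod_bij (fun j _ => ω ^ (j : ℕ)) ?_ ?_ ?_ ?_
  · intro j _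
    rw [Polynomial.mem_nthRootsFinset hm, ← pow_mul, mul_comm, pow_mul, h.pow_eq_one, one_pow]
  · intro i _ j _ hij
    exact Fin.ext (h.pow_inj i.2 j.2 hij)
  · intro b hb
    rw [Polynomial.mem_nthRootsFinset hm] at hb
    have : NeZero m := ⟨by omega⟩
    obtain ⟨i, hi, rfl⟩ := h.eq_pow_of_pow_eq_one hb
    exact ⟨⟨i, hi⟩, Finset.mem_univ _, rfl⟩
  · intro j _
    rfl

open PowerSeries in
lemma alg_id {m : ℕ} (hm : 1 ≤ m) (ω : ℂ) (h : IsPrimitiveRoot ω m) (x : ℕ → ℂ) (N k : ℕ) :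
    hs (fun i => x i ^ m) N k =
      ∑ n ∈ Finset.Nat.antidiagonalTuple m (m * k), ∏ j : Fin m, (ω ^ (j : ℕ)) ^ n j * hs x N (n j) := by
  have hm0 : m ≠ 0 := by omega
  have h1 : expand m hm0 (PowerSeries.mk (hs (fun i => x i ^ m) N)) *
      ∏ i ∈ Finset.range N, (1 - (C (x i) * X) ^ m) = 1 := by
    have := congrArg (expand m hm0) (hs_gen (fun i => x i ^ m) N)
    rw [map_mul, map_prod, map_one] at this
    refine Eq.trans ?_ this
    congr 1
    apply Finset.prod_congr rfl
    intro i _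
    rw [map_sub, map_one, map_mul, expand_C, expand_X, mul_pow, map_pow]
  have hC : IsPrimitiveRoot (C ω : PowerSeries ℂ) m := h.map_of_injective (f := C) (by
    exact PowerSeries.C_injective)
  have h2 : (∏ j : Fin m, rescale (ω ^ (j:ℕ)) (PowerSeries.mk (hs x N))) *
      ∏ i ∈ Finset.range N, (1 - (C (x i) * X) ^ m) = 1 := by
    have : ∏ i ∈ Finset.range N, (1 - (C (x i) * X) ^ m) =
      ∏ j : Fin m, rescale (ω ^ (j:ℕ)) (∏ i ∈ Finset.range N, (1 - C (x i) * X)) := by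
      simp_rw [map_prod]
      rw [Finset.prod_comm]
      apply Finset.prod_congr rfl
      intro i _
      rw [← rou_prod hm _ hC]
      apply Finset.prod_congr rfl
      intro j _
      rw [map_sub, map_one, map_mul, rescale_X, map_pow]
      have : rescale (ω ^ (j:ℕ)) (C (x i)) = C (x i) := by
        ext n
        rw [coeff_rescale, coeff_C]
        split_ifs with hn <;> simp [hn]
      rw [this]
      ring
    rw [this, ← Finset.prod_mul_distrib]
    simp_rw [← map_mul, hs_gen]
    simp
  have h3 := left_inv_eq_right_inv h1 ((mul_comm _ _).trans h2)
  have h4 := congrArg (coeff (m * k)) h3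
  rw [coeff_expand_mul, coeff_mk] at h4
  rw [h4, PowerSeries.coeff_prod, ← Finset.piAntidiag_univ_fin_eq_antidiagonalTuple]
  refine Finset.sum_bij (fun l _ => (l : Fin m → ℕ)) ?_ ?_ ?_ ?_
  · intro l hl
    simpa using hl
  · intro a _ b _ hab
    exact DFunLike.coe_injective hab
  · intro b hb
    refine ⟨Finsupp.equivFunOnFinite.symm b, ?_, ?_⟩
    · simpa using hb
    · simp
  · intro l _
    simp [coeff_rescale]

noncomputable def Hs (x : ℕ → ℝ) (k : ℕ) : ℝ :=
  ∑' f : {f : Fin k → ℕ // Antitone f}, ∏ i, x (f.1 i)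

lemma hs_le_pow (x : ℕ → ℝ) (hx : ∀ i, 0 ≤ x i) (N k : ℕ) :
    hs x N k ≤ (∑ i ∈ Finset.range N, x i) ^ k := by
  classical
  have : (∑ i ∈ Finset.range N, x i) ^ k =
      ∑ f ∈ Fintype.piFinset fun _ : Fin k => Finset.range N, ∏ i, x (f i) := by
    rw [Finset.sum_pow']
  rw [this]
  unfold hs
  apply Finset.sum_le_sum_of_subset_of_nonneg
  · convert Finset.filter_subset _ _
  · intro f _ _
    exact Finset.prod_nonneg fun i _ => hx _

lemma tendsto_hs (x : ℕ → ℝ) (hx : ∀ i, 0 ≤ x i) (hs' : Summable x) (k : ℕ) :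
    Filter.Tendsto (fun N => hs x N k) Filter.atTop (nhds (Hs x k)) := by
  classical
  set T : ℕ → Finset {f : Fin k → ℕ // Antitone f} := fun N =>
    (Fintype.piFinset fun _ : Fin k => Finset.range N).subtype (fun f => Antitone f) with hT
  have hsum : ∀ N, ∑ f ∈ T N, ∏ i, x (f.1 i) = hs x N k := by
    intro N
    rw [hT, hs]
    simp only
    rw [Finset.sum_subtype_eq_sum_filter (f := fun f : Fin k → ℕ => ∏ i, x (f i))]
  have hmono : Monotone T := by
    intro a b hab f
    simp only [hT, Finset.mem_subtype, Fintype.mem_piFinset, Finset.mem_range]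
    exact fun h i => (h i).trans_le hab
  have hTt : Filter.Tendsto T Filter.atTop Filter.atTop := by
    apply Filter.tendsto_atTop_finset_of_monotone hmono
    intro f
    refine ⟨(∑ i, f.1 i) + 1, ?_⟩
    simp only [hT, Finset.mem_subtype, Fintype.mem_piFinset, Finset.mem_range]
    intro i
    exact Nat.lt_succ_of_le (Finset.single_le_sum (f := f.1) (fun _ _ => Nat.zero_le _) (Finset.mem_univ i))
  have hS : Summable (fun f : {f : Fin k → ℕ // Antitone f} => ∏ i, x (f.1 i)) := by
    apply summable_of_sum_le (c := (∑' i, x i) ^ k)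
    · intro f; exact Finset.prod_nonneg fun i _ => hx _
    · intro u
      obtain ⟨N, hN⟩ := (hTt.eventually (Filter.eventually_ge_atTop u)).exists
      calc _ ≤ ∑ f ∈ T N, ∏ i, x (f.1 i) :=
            Finset.sum_le_sum_of_subset_of_nonneg hN fun f _ _ => Finset.prod_nonneg fun i _ => hx _
        _ = hs x N k := hsum N
        _ ≤ _ := hs_le_pow x hx N k
        _ ≤ _ := pow_le_pow_left₀ (Finset.sum_nonneg fun i _ => hx i) (hs'.sum_le_tsum _ fun i _ => hx i) _
  have := hS.hasSum.comp hTt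
  refine this.congr fun N => hsum N

lemma hs_nonneg (x : ℕ → ℝ) (hx : ∀ i, 0 ≤ x i) (N k : ℕ) : 0 ≤ hs x N k :=
  Finset.sum_nonneg fun _ _ => Finset.prod_nonneg fun i _ => hx _

lemma hs_mono (x : ℕ → ℝ) (hx : ∀ i, 0 ≤ x i) (k : ℕ) : Monotone fun N => hs x N k := by
  apply monotone_nat_of_le_succ
  intro N
  cases k with
  | zero => simp [hs_zero_right]
  | succ k =>
    rw [hs_succ]
    have := mul_nonneg (hx N) (hs_nonneg x hx (N+1) k)
    linarith

lemma hs_conv (x : ℕ → ℝ) (N n : ℕ) :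
    hs x (N+1) n = ∑ p ∈ Finset.HasAntidiagonal.antidiagonal n, hs x N p.1 * x N ^ p.2 := by
  induction n with
  | zero => simp [hs_zero_right]
  | succ n ih =>
    rw [Finset.Nat.sum_antidiagonal_succ', hs_succ, ih, Finset.mul_sum]
    simp only [pow_zero, mul_one, pow_succ]
    congr 1
    apply Finset.sum_congr rfl
    intros; ring

lemma hs_hasSum (x : ℕ → ℝ) (hx : ∀ i, 0 ≤ x i) (hx1 : ∀ i, x i ≤ 1) (y : ℝ) (hy : 0 < y)
    (hy1 : y < 1) (N : ℕ) :
    HasSum (fun n => hs x N n * y ^ n) (∏ i ∈ Finset.range N, (1 - x i * y))⁻¹ := by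
  induction N with
  | zero =>
    convert hasSum_single 0 ?_ using 1
    · simp [hs_zero_right]
    · intro n hn
      obtain ⟨n, rfl⟩ := Nat.exists_eq_succ_of_ne_zero hn
      simp [hs_zero_left]
  | succ N ih =>
    have h0 : 0 ≤ x N * y := mul_nonneg (hx N) hy.le
    have h1 : x N * y < 1 := by nlinarith [hx1 N]
    have hg := hasSum_geometric_of_lt_one h0 h1
    have e : (fun n => hs x (N+1) n * y ^ n) = fun n => ∑ p ∈ Finset.HasAntidiagonal.antidiagonal n,
        (hs x N p.1 * y ^ p.1) * (x N * y) ^ p.2 := by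
      funext n
      rw [hs_conv, Finset.sum_mul]
      apply Finset.sum_congr rfl
      intro p hp
      rw [← Finset.HasAntidiagonal.mem_antidiagonal.1 hp]
      ring
    have n1 := ih.summable.norm
    have n2 := hg.summable.norm
    rw [e, Finset.prod_range_succ, mul_inv, ← ih.tsum_eq, ← hg.tsum_eq,
      tsum_mul_tsum_eq_tsum_sum_antidiagonal_of_summable_norm n1 n2]
    exact (summable_norm_sum_mul_antidiagonal_of_summable_norm n1 n2).of_norm.hasSum

lemma Hs_hasSum (x : ℕ → ℝ) (hx : ∀ i, 0 ≤ x i) (hx1 : ∀ i, x i ≤ 1) (hxs : Summable x)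
    (y : ℝ) (hy : 0 < y) (hy1 : y < 1) (c : ℝ) (hc : c ≠ 0)
    (hlim : Filter.Tendsto (fun N => ∏ i ∈ Finset.range N, (1 - x i * y)) Filter.atTop (nhds c)) :
    HasSum (fun n => Hs x n * y ^ n) c⁻¹ := by
  have hl := hlim.inv₀ hc
  have hP := hs_hasSum x hx hx1 y hy hy1
  have hnn : ∀ N n, 0 ≤ hs x N n * y ^ n := fun N n => mul_nonneg (hs_nonneg x hx N n) (by positivity)
  have hmono : Monotone (fun N => (∏ i ∈ Finset.range N, (1 - x i * y))⁻¹) := by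
    intro a b hab
    refine hasSum_le (fun n => ?_) (hP a) (hP b)
    exact mul_le_mul_of_nonneg_right (hs_mono x hx n hab) (by positivity)
  have ht : ∀ n, Filter.Tendsto (fun N => hs x N n * y ^ n) Filter.atTop (nhds (Hs x n * y ^ n)) :=
    fun n => (tendsto_hs x hx hxs n).mul_const _
  have hHnn : ∀ n, 0 ≤ Hs x n * y ^ n := fun n => ge_of_tendsto' (ht n) fun N => hnn N n
  have hS : Summable (fun n => Hs x n * y ^ n) := by
    apply summable_of_sum_range_le (c := c⁻¹) hHnn
    intro K
    refine le_of_tendsto' (tendsto_finsetSum (Finset.range K) fun n _ => ht n) fun N => ?_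
    exact (sum_le_hasSum _ (fun n _ => hnn N n) (hP N)).trans (hmono.ge_of_tendsto hl N)
  have hd := tendsto_tsum_of_dominated_convergence (𝓕 := Filter.atTop) hS ht
    (Filter.Eventually.of_forall fun N n => by
      rw [Real.norm_of_nonneg (hnn N n)]
      exact mul_le_mul_of_nonneg_right ((hs_mono x hx n).ge_of_tendsto (tendsto_hs x hx hxs n) N) (by positivity))
  have : ∑' n, Hs x n * y ^ n = c⁻¹ := by
    refine tendsto_nhds_unique hd (hl.congr fun N => (hP N).tsum_eq.symm)
  rw [← this]
  exact hS.hasSum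

lemma cos_prod (x : ℝ) (h0 : 0 < x) (h1 : x < 1) :
    Filter.Tendsto (fun N => ∏ i ∈ Finset.range N, (1 - 1 / (2 * (i:ℝ) + 1) ^ 2 * x ^ 2)) Filter.atTop
      (nhds (Real.cos (π / 2 * x))) := by
  have A := (Real.tendsto_euler_sin_prod x).comp
    (Filter.tendsto_id.const_mul_atTop' (show (0:ℕ) < 2 by norm_num))
  have B := Real.tendsto_euler_sin_prod (x / 2)
  have hsin : Real.sin (π * (x / 2)) ≠ 0 := by
    apply ne_of_gt
    apply Real.sin_pos_of_pos_of_lt_pi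
    · positivity
    · nlinarith [Real.pi_pos]
  have C := A.div B hsin |>.div_const 2
  have e : Real.sin (π * x) / Real.sin (π * (x / 2)) / 2 = Real.cos (π / 2 * x) := by
    rw [show π * x = 2 * (π * (x / 2)) by ring, Real.sin_two_mul, show π / 2 * x = π * (x/2) by ring, div_div, div_eq_iff (mul_ne_zero hsin two_ne_zero)]
    ring
  rw [e] at C
  refine C.congr fun N => ?_
  have hf : ∀ M : ℕ, ∏ j ∈ Finset.range (2 * M), (1 - x ^ 2 / ((j:ℝ) + 1) ^ 2) =
      (∏ i ∈ Finset.range M, (1 - 1 / (2 * (i:ℝ) + 1) ^ 2 * x ^ 2)) *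
      ∏ j ∈ Finset.range M, (1 - (x/2) ^ 2 / ((j:ℝ) + 1) ^ 2) := by
    intro M
    induction M with
    | zero => simp
    | succ M ih =>
      rw [show 2 * (M + 1) = 2 * M + 1 + 1 by ring, Finset.prod_range_succ, Finset.prod_range_succ, ih,
        Finset.prod_range_succ, Finset.prod_range_succ]
      have e1 : (1 - x ^ 2 / (((2 * M : ℕ):ℝ) + 1) ^ 2) = (1 - 1 / (2 * (M:ℝ) + 1) ^ 2 * x ^ 2) := by
        push_cast; ring
      have e2 : (1 - x ^ 2 / (((2 * M + 1 : ℕ):ℝ) + 1) ^ 2) = (1 - (x/2) ^ 2 / ((M:ℝ) + 1) ^ 2) := by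
        push_cast
        rw [show 2 * (M:ℝ) + 1 + 1 = 2 * (M + 1) by ring]
        field_simp
      rw [e1, e2]; ring
  have hne : ∏ j ∈ Finset.range N, (1 - (x/2) ^ 2 / ((j:ℝ) + 1) ^ 2) ≠ 0 := by
    rw [Finset.prod_ne_zero_iff]
    intro j _
    apply ne_of_gt
    rw [sub_pos, div_lt_one (by positivity)]
    have : (0:ℝ) ≤ j := by positivity
    nlinarith
  simp only [Pi.div_apply, Function.comp_apply, id]
  rw [hf N]
  have := Real.pi_pos.ne'
  generalize (∏ i ∈ Finset.range N, (1 - 1 / (2 * (i:ℝ) + 1) ^ 2 * x ^ 2)) = a at *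
  generalize (∏ j ∈ Finset.range N, (1 - (x/2) ^ 2 / ((j:ℝ) + 1) ^ 2)) = b at *
  field_simp

lemma coeff_unique (d : ℕ → ℝ) (h : ∀ y : ℝ, 0 < y → y < 1 → HasSum (fun n => d n * y ^ n) 0) :
    ∀ n, d n = 0 := by
  set p := FormalMultilinearSeries.ofScalars ℝ d with hp
  have hr : (1/2 : NNReal) ≤ p.radius := by
    apply FormalMultilinearSeries.le_radius_of_summable
    have := (h (1/2) (by norm_num) (by norm_num)).summable.norm
    refine this.congr fun n => ?_
    rw [hp, FormalMultilinearSeries.ofScalars_norm]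
    simp
  have hf : HasFPowerSeriesAt p.sum p 0 :=
    (p.hasFPowerSeriesOnBall (lt_of_lt_of_le (by norm_num) hr)).hasFPowerSeriesAt
  have hz : ∀ y : ℝ, 0 < y → y < 1 → p.sum y = 0 := by
    intro y h0 h1
    rw [FormalMultilinearSeries.sum, ← (h y h0 h1).tsum_eq]
    congr 1
    funext n
    rw [hp, FormalMultilinearSeries.ofScalars_apply_eq]
    simp
  have hfr : ∃ᶠ z in nhdsWithin (0:ℝ) {0}ᶜ, p.sum z = 0 := by
    have : ∀ᶠ z in nhdsWithin (0:ℝ) (Set.Ioi 0), p.sum z = 0 := by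
      filter_upwards [Ioo_mem_nhdsGT (show (0:ℝ) < 1 by norm_num)] with z hz'
      exact hz z hz'.1 hz'.2
    exact this.frequently.filter_mono (nhdsWithin_mono _ fun z hz => ne_of_gt hz)
  have hev := hf.analyticAt.frequently_zero_iff_eventually_zero.1 hfr
  have hp0 : p = 0 := (hf.congr hev).eq_zero
  intro n
  rw [hp, FormalMultilinearSeries.ofScalars_series_eq_zero] at hp0
  exact congrFun hp0 n

lemma xs_summable : Summable (fun i : ℕ => 1 / (2 * (i:ℝ) + 1) ^ 2) := by
  have := (summable_nat_add_iff 1).2 (Real.summable_one_div_nat_pow.2 (show 1 < 2 by norm_num))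
  refine this.of_nonneg_of_le (fun i => by positivity) fun i => ?_
  push_cast
  gcongr
  have : (0:ℝ) ≤ i := by positivity
  linarith

lemma xs_le_one (i : ℕ) : 1 / (2 * (i:ℝ) + 1) ^ 2 ≤ 1 := by
  rw [div_le_one (by positivity)]
  have : (0:ℝ) ≤ i := by positivity
  nlinarith

lemma Hs_eq (E : ℕ → ℝ)
    (hE : ∀ x : ℝ, |x| < π / 2 →
      HasSum (fun n : ℕ => (-1 : ℝ) ^ n * E (2 * n) * x ^ (2 * n) /
        Nat.factorial (2 * n)) (1 / Real.cos x)) (n : ℕ) :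
    Hs (fun i => 1 / (2 * (i:ℝ) + 1) ^ 2) n =
      (-1 : ℝ) ^ n * E (2 * n) * (π / 2) ^ (2 * n) / Nat.factorial (2 * n) := by
  rw [← sub_eq_zero]
  refine coeff_unique (fun n => Hs (fun i => 1 / (2 * (i:ℝ) + 1) ^ 2) n -
      (-1 : ℝ) ^ n * E (2 * n) * (π / 2) ^ (2 * n) / Nat.factorial (2 * n)) ?_ n
  intro y h0 h1
  have s0 : 0 < √y := Real.sqrt_pos.2 h0
  have s1 : √y < 1 := by rw [Real.sqrt_lt' one_pos]; simpa using h1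
  have s2 : √y ^ 2 = y := Real.sq_sqrt h0.le
  have hlt : |π / 2 * √y| < π / 2 := by
    rw [abs_of_pos (by positivity)]
    nlinarith [Real.pi_pos]
  have hc : Real.cos (π / 2 * √y) ≠ 0 := by
    apply ne_of_gt
    exact Real.cos_pos_of_mem_Ioo (abs_lt.1 hlt)
  have hl := cos_prod _ s0 s1
  rw [s2] at hl
  have H1 := Hs_hasSum _ (fun i => by positivity) xs_le_one xs_summable y h0 h1 _ hc hl
  have H2 := hE _ hlt
  rw [one_div] at H2
  have := H1.sub H2
  rw [sub_self] at this
  refine (congrArg (fun g : ℕ → ℝ => HasSum g 0) (funext fun b => ?_)).mpr this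
  rw [mul_pow, pow_mul (√y), s2]
  ring

lemma multTStar_eq (m k : ℕ) : multTStar (fun _ : Fin k => 2 * m) =
    Hs (fun i => (1 / (2 * (i:ℝ) + 1) ^ 2) ^ m) k := by
  unfold multTStar Hs
  let e : {f : Fin k → ℕ // Antitone f} ≃ {f : Fin k → ℕ // Antitone f ∧ ∀ i, Odd (f i)} :=
    { toFun := fun f => ⟨fun i => 2 * f.1 i + 1, fun i j h => by
          have := f.2 h
          show 2 * f.1 j + 1 ≤ 2 * f.1 i + 1
          omega, fun i => ⟨f.1 i, rfl⟩⟩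
      invFun := fun f => ⟨fun i => f.1 i / 2, fun i j h => Nat.div_le_div_right (f.2.1 h)⟩
      left_inv := fun f => by
        ext i
        simp only
        omega
      right_inv := fun f => by
        ext i
        have := (Nat.odd_iff.1 (f.2.2 i))
        simp only
        omega }
  rw [← e.tsum_eq]
  congr 1
  funext f
  apply Finset.prod_congr rfl
  intro i _
  simp only [e, Equiv.coe_fn_mk]
  push_cast
  rw [pow_mul, div_pow, one_pow]

theorem multTStar_repeat_even_eq_euler_sum (E : ℕ → ℝ)
    (hE : ∀ x : ℝ, |x| < π / 2 →
      HasSum (fun n : ℕ => (-1 : ℝ) ^ n * E (2 * n) * x ^ (2 * n) /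
        Nat.factorial (2 * n)) (1 / Real.cos x))
    (m k : ℕ) (hm : 1 ≤ m) (hk : 1 ≤ k) :
    (multTStar (fun _ : Fin k => 2 * m) : ℂ) =
      ((-1 : ℂ) ^ (m * k) / Nat.factorial (2 * m * k)) * ((π : ℂ) / 2) ^ (2 * m * k) *
        ∑ n ∈ Finset.Nat.antidiagonalTuple m (m * k),
          ((Nat.factorial (2 * m * k) : ℂ) / ∏ j, (Nat.factorial (2 * n j) : ℂ)) *
            ∏ j : Fin m,
              Complex.exp (2 * Real.pi * Complex.I / m * (j : ℕ) * (n j)) *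
                (E (2 * n j) : ℂ) := by
  set x : ℕ → ℝ := fun i => 1 / (2 * (i:ℝ) + 1) ^ 2 with hx
  set ω : ℂ := Complex.exp (2 * π * Complex.I / m) with hω
  have hprim : IsPrimitiveRoot ω m := Complex.isPrimitiveRoot_exp m (by omega)
  have hx0 : ∀ i, 0 ≤ x i := fun i => by positivity
  have hxs : Summable x := xs_summable
  have hxm : Summable (fun i => x i ^ m) := by
    refine hxs.of_nonneg_of_le (fun i => pow_nonneg (hx0 i) _) fun i => ?_
    exact pow_le_of_le_one (hx0 i) (xs_le_one i) (by omega)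
  have hcast : ∀ (z : ℕ → ℝ) (N n : ℕ), ((hs z N n : ℝ) : ℂ) = hs (fun i => (z i : ℂ)) N n := by
    intro z N n
    unfold hs
    push_cast
    rfl
  have L : Filter.Tendsto (fun N => ((hs (fun i => x i ^ m) N k : ℝ) : ℂ)) Filter.atTop
      (nhds ((Hs (fun i => x i ^ m) k : ℝ) : ℂ)) :=
    (Complex.continuous_ofReal.tendsto _).comp
      (tendsto_hs _ (fun i => pow_nonneg (hx0 i) _) hxm k)
  have R : Filter.Tendsto (fun N => ((hs (fun i => x i ^ m) N k : ℝ) : ℂ)) Filter.atTop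
      (nhds (∑ n ∈ Finset.Nat.antidiagonalTuple m (m * k),
        ∏ j : Fin m, (ω ^ (j : ℕ)) ^ n j * ((Hs x (n j) : ℝ) : ℂ))) := by
    have : ∀ N, ((hs (fun i => x i ^ m) N k : ℝ) : ℂ) =
      ∑ n ∈ Finset.Nat.antidiagonalTuple m (m * k),
        ∏ j : Fin m, (ω ^ (j : ℕ)) ^ n j * ((hs x N (n j) : ℝ) : ℂ) := by
      intro N
      simp_rw [hcast]
      push_cast
      exact alg_id hm ω hprim _ N k
    simp_rw [this]
    refine tendsto_finsetSum _ fun n _ => tendsto_finsetProd _ fun j _ => ?_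
    exact ((Complex.continuous_ofReal.tendsto _).comp (tendsto_hs x hx0 hxs (n j))).const_mul _
  rw [multTStar_eq, tendsto_nhds_unique L R, Finset.mul_sum]
  apply Finset.sum_congr rfl
  intro n hn
  have hn' : ∑ j, n j = m * k := Finset.Nat.mem_antidiagonalTuple.1 hn
  have hj : ∀ j : Fin m, (ω ^ (j : ℕ)) ^ n j * ((Hs x (n j) : ℝ) : ℂ) =
      (-1) ^ n j * ((π:ℂ)/2) ^ (2 * n j) * ((Nat.factorial (2 * n j) : ℂ))⁻¹ *
        (Complex.exp (2 * Real.pi * Complex.I / m * (j : ℕ) * (n j)) * (E (2 * n j) : ℂ)) := by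
    intro j
    rw [hx, Hs_eq E hE]
    have : (ω ^ (j : ℕ)) ^ n j = Complex.exp (2 * Real.pi * Complex.I / m * (j : ℕ) * (n j)) := by
      rw [hω, ← Complex.exp_nat_mul, ← Complex.exp_nat_mul]
      congr 1; ring
    rw [this]
    push_cast
    ring
  simp_rw [hj]
  rw [Finset.prod_mul_distrib, Finset.prod_mul_distrib, Finset.prod_mul_distrib,
    Finset.prod_pow_eq_pow_sum, Finset.prod_pow_eq_pow_sum, ← Finset.mul_sum, hn',
    Finset.prod_inv_distrib, ← mul_assoc 2 m k]
  have hf : (Nat.factorial (2 * m * k) : ℂ) ≠ 0 := by exact_mod_cast Nat.factorial_ne_zero _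
  rw [div_eq_mul_inv _ (∏ j, (Nat.factorial (2 * n j) : ℂ))]
  field_simp
end

section
/- For all real numbers x and y with |x| < 1 and |y| < 1, Σ_{i≥1, j≥1} t(i+1, {1}_{j−1}) x^i y^j = (xy/(1−x)) · Σ_{s=0}^{∞} [ (1/2 + y/2)_s (1/2 − x/2)_s ] / [ (3/2)_s (3/2 − x/2)_s ], where (a)_s = a(a+1)···(a+s−1) is the Pochhammer symbol with (a)_0 = 1. (The right-hand side equals (xy/(1−x)) · ₃F₂(1/2 + y/2, 1/2 − x/2, 1; 3/2, 3/2 − x/2; 1).) -/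
open Polynomial

/-- Multiple t-value: sum over strictly decreasing tuples of odd positive
integers. -/
noncomputable def multT {k : ℕ} (a : Fin k → ℕ) : ℝ :=
  ∑' n : {f : Fin k → ℕ // StrictAnti f ∧ ∀ i, Odd (f i)},
    ∏ i, 1 / ((n.1 i : ℝ) ^ (a i))

lemma tv_strictAnti {j s : ℕ} (A : Finset ℕ) (hA : A ⊆ Finset.range s) (hc : A.card = j) :
    StrictAnti (Fin.cons (2 * s + 1) (fun i : Fin j => 2 * A.orderEmbOfFin hc i.rev + 1) :
      Fin (j + 1) → ℕ) := by
  intro a b hab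
  induction b using Fin.cases with
  | zero => exact absurd hab (by simp)
  | succ b =>
    induction a using Fin.cases with
    | zero =>
      have := Finset.mem_range.1 (hA (Finset.orderEmbOfFin_mem A hc b.rev))
      simp only [Fin.cons_zero, Fin.cons_succ]
      omega
    | succ a =>
      have h : a < b := by simpa using hab
      have : A.orderEmbOfFin hc b.rev < A.orderEmbOfFin hc a.rev :=
        (A.orderEmbOfFin hc).strictMono (Fin.rev_lt_rev.2 h)
      simp only [Fin.cons_succ]
      omega

def tvMap (j : ℕ) (q : Σ s : ℕ, {A : Finset ℕ // A ∈ Finset.powersetCard j (Finset.range s)}) :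
    {f : Fin (j + 1) → ℕ // StrictAnti f ∧ ∀ i, Odd (f i)} :=
  ⟨Fin.cons (2 * q.1 + 1) (fun i : Fin j =>
      2 * q.2.1.orderEmbOfFin (Finset.mem_powersetCard.1 q.2.2).2 i.rev + 1),
    tv_strictAnti _ (Finset.mem_powersetCard.1 q.2.2).1 _, by
      intro i
      induction i using Fin.cases with
      | zero => simp
      | succ i => simp⟩

lemma tvMap_bij (j : ℕ) : Function.Bijective (tvMap j) := by
  constructor
  · rintro ⟨s, A, hA⟩ ⟨s', A', hA'⟩ h
    have h1 := congrArg Subtype.val h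
    simp only [tvMap] at h1
    have h0 := congrFun h1 0
    simp only [Fin.cons_zero] at h0
    obtain rfl : s = s' := by omega
    have h2 : ∀ i, A.orderEmbOfFin (Finset.mem_powersetCard.1 hA).2 i =
        A'.orderEmbOfFin (Finset.mem_powersetCard.1 hA').2 i := by
      intro i
      have := congrFun h1 i.rev.succ
      simp only [Fin.cons_succ, Fin.rev_rev] at this
      omega
    have h3 : A = A' := by
      rw [← Finset.coe_inj, ← Finset.range_orderEmbOfFin A (Finset.mem_powersetCard.1 hA).2,
        ← Finset.range_orderEmbOfFin A' (Finset.mem_powersetCard.1 hA').2]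
      congr 1
      funext i
      exact h2 i
    subst h3
    rfl
  · rintro ⟨f, hf, ho⟩
    have hd : ∀ i, 2 * (f i / 2) + 1 = f i := fun i => by
      obtain ⟨k, hk⟩ := ho i
      omega
    have hmono : StrictMono (fun i : Fin j => f i.rev.succ / 2) := by
      intro a b hab
      have : f a.rev.succ < f b.rev.succ := hf (by simpa using hab)
      have h1 := hd a.rev.succ
      have h2 := hd b.rev.succ
      simp only
      omega
    have hc : (Finset.univ.image (fun i : Fin j => f i.rev.succ / 2)).card = j := by
      rw [Finset.card_image_of_injective _ hmono.injective]; simp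
    have hmem : Finset.univ.image (fun i : Fin j => f i.rev.succ / 2) ∈
        Finset.powersetCard j (Finset.range (f 0 / 2)) := by
      rw [Finset.mem_powersetCard]
      refine ⟨?_, hc⟩
      intro a ha
      obtain ⟨i, -, rfl⟩ := Finset.mem_image.1 ha
      have : f i.rev.succ < f 0 := hf (Fin.succ_pos _)
      have h1 := hd i.rev.succ
      have h2 := hd 0
      rw [Finset.mem_range]
      omega
    refine ⟨⟨f 0 / 2, _, hmem⟩, ?_⟩
    apply Subtype.ext
    funext i
    simp only [tvMap]
    induction i using Fin.cases with
    | zero => simpa using hd 0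
    | succ i =>
      have := Finset.orderEmbOfFin_unique hc (f := fun i : Fin j => f i.rev.succ / 2)
        (fun x => Finset.mem_image_of_mem _ (Finset.mem_univ x)) hmono
      have h2 := congrFun this i.rev
      simp only [Fin.rev_rev] at h2
      simp only [Fin.cons_succ]
      rw [← h2]
      exact hd _

noncomputable def tvE (s j : ℕ) : ℝ :=
  ∑ A ∈ Finset.powersetCard j (Finset.range s), ∏ a ∈ A, (1 / (2 * (a : ℝ) + 1))

noncomputable def tvP (s : ℕ) (y : ℝ) : ℝ := ∏ r ∈ Finset.range s, (1 + y / (2 * (r : ℝ) + 1))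

lemma tvE_nonneg (s j : ℕ) : 0 ≤ tvE s j :=
  Finset.sum_nonneg fun A _ => Finset.prod_nonneg fun a _ => by positivity

lemma tvE_sum (s : ℕ) (y : ℝ) :
    ∑ j ∈ Finset.range (s + 1), tvE s j * y ^ j = tvP s y := by
  unfold tvP tvE
  rw [Finset.prod_one_add, Finset.sum_powerset, Finset.card_range]
  refine Finset.sum_congr rfl fun j _ => ?_
  rw [Finset.sum_mul]
  refine Finset.sum_congr rfl fun A hA => ?_
  rw [← (Finset.mem_powersetCard.1 hA).2, ← Finset.prod_const, ← Finset.prod_mul_distrib]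
  refine Finset.prod_congr rfl fun a _ => by ring

lemma tvE_zero {s j : ℕ} (h : s < j) : tvE s j = 0 := by
  unfold tvE
  rw [Finset.powersetCard_eq_empty.2 (by simpa using h)]
  simp

lemma tvE_hasSum (s : ℕ) (y : ℝ) : HasSum (fun j => tvE s j * y ^ j) (tvP s y) := by
  rw [← tvE_sum]
  apply hasSum_sum_of_ne_finset_zero
  intro j hj
  rw [tvE_zero (by simpa using hj), zero_mul]

lemma tvE_le (s j : ℕ) : tvE s j ≤ tvP s 1 := by
  have := le_hasSum (tvE_hasSum s 1) j (fun i _ => by simpa using tvE_nonneg s i)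
  simpa using this

lemma tvP_nonneg (s : ℕ) : 0 ≤ tvP s 1 := Finset.prod_nonneg fun a _ => by positivity

lemma tvP_sq (s : ℕ) : tvP (s + 1) 1 ^ 2 ≤ 4 * ((s : ℝ) + 1) := by
  induction s with
  | zero => simp [tvP]; norm_num
  | succ s ih =>
    have : tvP (s + 1 + 1) 1 = tvP (s + 1) 1 * (1 + 1 / (2 * ((s + 1 : ℕ) : ℝ) + 1)) := by
      unfold tvP
      rw [Finset.prod_range_succ]
    rw [this, mul_pow]
    have h2 : (1 + 1 / (2 * ((s + 1 : ℕ) : ℝ) + 1)) ^ 2 ≤ ((s : ℝ) + 2) / (s + 1) := by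
      push_cast
      have : (1 + 1 / (2 * ((s : ℝ) + 1) + 1)) = (2 * s + 4) / (2 * s + 3) := by
        field_simp; ring
      rw [this, div_pow, div_le_div_iff₀ (by positivity) (by positivity)]
      nlinarith [(Nat.cast_nonneg s : (0:ℝ) ≤ s)]
    calc _ ≤ 4 * ((s : ℝ) + 1) * (((s : ℝ) + 2) / (s + 1)) := by gcongr
      _ = _ := by push_cast; field_simp; ring

lemma tvP_le (s : ℕ) : tvP s 1 ≤ 2 * Real.sqrt ((s : ℝ) + 1) := by
  have : tvP s 1 ^ 2 ≤ 4 * ((s : ℝ) + 1) := by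
    cases s with
    | zero => simp [tvP]
    | succ s => have := tvP_sq s; push_cast; linarith
  have h2 : (2 * Real.sqrt ((s : ℝ) + 1)) ^ 2 = 4 * ((s : ℝ) + 1) := by
    rw [mul_pow, Real.sq_sqrt (by positivity)]; norm_num
  exact le_of_sq_le_sq (by rw [h2]; exact this) (by positivity)

lemma tv_summable : Summable (fun s : ℕ => tvP s 1 / (2 * (s : ℝ) + 1) ^ 2) := by
  have h : Summable (fun s : ℕ => 2 * (1 / (((s + 1 : ℕ) : ℝ)) ^ (3 / 2 : ℝ))) :=
    ((summable_nat_add_iff 1).2 (Real.summable_one_div_nat_rpow.2 (by norm_num))).mul_left 2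
  refine Summable.of_nonneg_of_le (fun s => div_nonneg (tvP_nonneg s) (by positivity)) ?_ h
  intro s
  have hs : (0:ℝ) < (s : ℝ) + 1 := by positivity
  have e : (((s + 1 : ℕ) : ℝ)) ^ (3 / 2 : ℝ) = (s + 1) * Real.sqrt (s + 1) := by
    push_cast
    rw [show (3 / 2 : ℝ) = 1 + 1 / 2 by norm_num, Real.rpow_add hs, Real.rpow_one,
      Real.sqrt_eq_rpow]
  have hq : 0 < Real.sqrt ((s : ℝ) + 1) := Real.sqrt_pos.2 hs
  rw [e]
  calc _ ≤ 2 * Real.sqrt ((s : ℝ) + 1) / ((s : ℝ) + 1) ^ 2 := by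
        gcongr
        · exact tvP_le s
        · linarith [(Nat.cast_nonneg s : (0:ℝ) ≤ s)]
    _ = _ := by
        have : Real.sqrt ((s : ℝ) + 1) * Real.sqrt ((s : ℝ) + 1) = s + 1 :=
          Real.mul_self_sqrt hs.le
        rw [mul_one_div, div_eq_div_iff (by positivity) (by positivity)]
        linear_combination 2 * ((s : ℝ) + 1) * this

lemma tvS_bound (i j s : ℕ) :
    tvE s j / (2 * (s : ℝ) + 1) ^ (i + 2) ≤ tvP s 1 / (2 * (s : ℝ) + 1) ^ 2 := by
  have := (Nat.cast_nonneg s : (0:ℝ) ≤ s)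
  gcongr
  · exact tvP_nonneg s
  · exact tvE_le s j
  · linarith
  · omega

lemma tvS_nonneg (i j s : ℕ) : 0 ≤ tvE s j / (2 * (s : ℝ) + 1) ^ (i + 2) :=
  div_nonneg (tvE_nonneg _ _) (by positivity)

lemma multT_eq (i j : ℕ) :
    multT (fun s : Fin (j + 1) => if s = 0 then i + 2 else 1) =
      ∑' s : ℕ, tvE s j / (2 * (s : ℝ) + 1) ^ (i + 2) := by
  unfold multT
  rw [← (Equiv.ofBijective _ (tvMap_bij j)).tsum_eq]
  have key : ∀ q : Σ s : ℕ, {A : Finset ℕ // A ∈ Finset.powersetCard j (Finset.range s)},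
      ∏ k : Fin (j + 1), 1 / ((((Equiv.ofBijective _ (tvMap_bij j)) q).1 k : ℝ) ^
        (if k = 0 then i + 2 else 1)) =
      (∏ a ∈ q.2.1, (1 / (2 * (a : ℝ) + 1))) / (2 * (q.1 : ℝ) + 1) ^ (i + 2) := by
    rintro ⟨s, A, hA⟩
    have hc := (Finset.mem_powersetCard.1 hA).2
    rw [Fin.prod_univ_succ]
    simp only [Equiv.ofBijective_apply, tvMap, Fin.cons_zero, Fin.cons_succ, if_true,
      Fin.succ_ne_zero, if_false, pow_one]
    have : ∏ a ∈ A, (1 / (2 * (a : ℝ) + 1)) =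
        ∏ k : Fin j, (1 / (2 * (A.orderEmbOfFin hc k : ℝ) + 1)) := by
      conv_lhs => rw [← Finset.image_orderEmbOfFin_univ A hc]
      rw [Finset.prod_image (fun a _ b _ h => (A.orderEmbOfFin hc).injective h)]
    rw [this, ← Equiv.prod_comp Fin.revPerm]
    push_cast
    simp only [Fin.revPerm_apply, Fin.rev_rev]
    ring
  simp_rw [key]
  have fib : ∀ s : ℕ, ∑' A : {A : Finset ℕ // A ∈ Finset.powersetCard j (Finset.range s)},
      (∏ a ∈ A.1, (1 / (2 * (a : ℝ) + 1))) / (2 * (s : ℝ) + 1) ^ (i + 2) =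
      tvE s j / (2 * (s : ℝ) + 1) ^ (i + 2) := by
    intro s
    rw [Finset.tsum_subtype (Finset.powersetCard j (Finset.range s))
      (fun A => (∏ a ∈ A, (1 / (2 * (a : ℝ) + 1))) / (2 * (s : ℝ) + 1) ^ (i + 2)),
      tvE, Finset.sum_div]
  rw [Summable.tsum_sigma]
  · simp_rw [fib]
  · rw [summable_sigma_of_nonneg]
    · refine ⟨fun s => (hasSum_fintype _).summable, ?_⟩
      simp_rw [fib]
      exact Summable.of_nonneg_of_le (tvS_nonneg i j) (tvS_bound i j) tv_summable
    · rintro ⟨s, A, hA⟩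
      exact div_nonneg (Finset.prod_nonneg fun a _ => by positivity) (by positivity)

lemma tv_poch (s : ℕ) (x y : ℝ) (hx : |x| < 1) :
    x * y / (1 - x) * (((ascPochhammer ℝ s).eval (1 / 2 + y / 2) *
              (ascPochhammer ℝ s).eval (1 / 2 - x / 2)) /
            ((ascPochhammer ℝ s).eval (3 / 2) *
              (ascPochhammer ℝ s).eval (3 / 2 - x / 2))) =
      x * y * tvP s y / ((2 * (s : ℝ) + 1) * (2 * s + 1 - x)) := by
  have hx1 := (abs_lt.1 hx).2
  have h1 : 1 - x ≠ 0 := by linarith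
  induction s with
  | zero => simp [tvP]
  | succ s ih =>
    have hs := (Nat.cast_nonneg s : (0:ℝ) ≤ s)
    have e : tvP (s + 1) y = tvP s y * (1 + y / (2 * (s : ℝ) + 1)) := by
      unfold tvP
      rw [Finset.prod_range_succ]
    rw [e]
    simp only [ascPochhammer_succ_eval]
    have h2 : 2 * (s : ℝ) + 1 - x ≠ 0 := by linarith
    have h3 : 2 * ((s : ℝ) + 1) + 1 - x ≠ 0 := by linarith
    have h4 : 2 * (s : ℝ) + 1 ≠ 0 := by linarith
    have h5 : 2 * ((s : ℝ) + 1) + 1 ≠ 0 := by linarith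
    calc _ = (x * y / (1 - x) * (((ascPochhammer ℝ s).eval (1 / 2 + y / 2) *
              (ascPochhammer ℝ s).eval (1 / 2 - x / 2)) /
            ((ascPochhammer ℝ s).eval (3 / 2) *
              (ascPochhammer ℝ s).eval (3 / 2 - x / 2)))) *
              (((1 / 2 + y / 2 + s) * (1 / 2 - x / 2 + s)) /
                ((3 / 2 + s) * (3 / 2 - x / 2 + s))) := by
            simp only [div_eq_mul_inv, mul_inv]; ring
      _ = _ := by
        rw [ih]
        push_cast
        have e1 : (1 / 2 + y / 2 + s : ℝ) = (2 * s + 1 + y) / 2 := by ring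
        have e2 : (1 / 2 - x / 2 + s : ℝ) = (2 * s + 1 - x) / 2 := by ring
        have e3 : (3 / 2 + s : ℝ) = (2 * (s + 1) + 1) / 2 := by ring
        have e4 : (3 / 2 - x / 2 + s : ℝ) = (2 * (s + 1) + 1 - x) / 2 := by ring
        rw [e1, e2, e3, e4]
        field_simp

lemma tv_geom (s : ℕ) (x : ℝ) (hx : |x| < 1) :
    HasSum (fun i : ℕ => x ^ (i + 1) / (2 * (s : ℝ) + 1) ^ (i + 2))
      (x / ((2 * (s : ℝ) + 1) * (2 * s + 1 - x))) := by
  have hs := (Nat.cast_nonneg s : (0:ℝ) ≤ s)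
  have hx1 := (abs_lt.1 hx).2
  have h2 : 2 * (s : ℝ) + 1 - x ≠ 0 := by linarith
  have h4 : 0 < 2 * (s : ℝ) + 1 := by linarith
  have hr : |x / (2 * (s : ℝ) + 1)| < 1 := by
    rw [abs_div, abs_of_pos h4, div_lt_one h4]; linarith
  have := (hasSum_geometric_of_abs_lt_one hr).mul_left (x / (2 * (s : ℝ) + 1) ^ 2)
  have h5 : 1 - x / (2 * (s : ℝ) + 1) = (2 * s + 1 - x) / (2 * (s : ℝ) + 1) := by field_simp
  have e1 : (fun i : ℕ => x ^ (i + 1) / (2 * (s : ℝ) + 1) ^ (i + 2)) =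
      fun i : ℕ => x / (2 * (s : ℝ) + 1) ^ 2 * (x / (2 * (s : ℝ) + 1)) ^ i := by
    funext i
    rw [div_pow]; field_simp; ring
  have e2 : x / ((2 * (s : ℝ) + 1) * (2 * s + 1 - x)) =
      x / (2 * (s : ℝ) + 1) ^ 2 * (1 - x / (2 * (s : ℝ) + 1))⁻¹ := by
    rw [h5]; field_simp
  rw [e1, e2]
  exact this

lemma tv_sum2 (x y : ℝ) (hx : |x| < 1) (hy : |y| < 1) : Summable (fun q : (ℕ × ℕ) × ℕ =>
    tvE q.2 q.1.2 / (2 * (q.2 : ℝ) + 1) ^ (q.1.1 + 2) * x ^ (q.1.1 + 1) * y ^ (q.1.2 + 1)) := by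
  have hX : Summable (fun i : ℕ => |x| ^ (i + 1)) :=
    (summable_nat_add_iff 1).2 (summable_geometric_of_lt_one (abs_nonneg x) hx)
  have hY : Summable (fun i : ℕ => |y| ^ (i + 1)) :=
    (summable_nat_add_iff 1).2 (summable_geometric_of_lt_one (abs_nonneg y) hy)
  have hXY := hX.mul_of_nonneg hY (fun i => by positivity) (fun i => by positivity)
  have hA := hXY.mul_of_nonneg tv_summable (fun i => by positivity)
    (fun s => div_nonneg (tvP_nonneg s) (by positivity))
  refine Summable.of_norm_bounded hA ?_
  rintro ⟨⟨i, j⟩, s⟩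
  simp only [Real.norm_eq_abs, abs_mul, abs_pow, abs_of_nonneg (tvS_nonneg i j s)]
  calc _ = |x| ^ (i + 1) * |y| ^ (j + 1) * (tvE s j / (2 * (s : ℝ) + 1) ^ (i + 2)) := by ring
    _ ≤ _ := by
      gcongr ?_ * ?_
      exact tvS_bound i j s

lemma tv_inner (x y : ℝ) (hx : |x| < 1) (s : ℕ) :
    ∑' p : ℕ × ℕ, tvE s p.2 / (2 * (s : ℝ) + 1) ^ (p.1 + 2) * x ^ (p.1 + 1) * y ^ (p.2 + 1) =
      x * y * tvP s y / ((2 * (s : ℝ) + 1) * (2 * s + 1 - x)) := by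
  have h1 := tv_geom s x hx
  have h2 : HasSum (fun j => tvE s j * y ^ (j + 1)) (y * tvP s y) := by
    have h := (tvE_hasSum s y).mul_left y
    have e : (fun j => tvE s j * y ^ (j + 1)) = fun j => y * (tvE s j * y ^ j) := by
      funext j; ring
    rw [e]
    exact h
  have h3 := tsum_mul_tsum_of_summable_norm h1.summable.norm h2.summable.norm
  rw [h1.tsum_eq, h2.tsum_eq] at h3
  have e1 : (fun p : ℕ × ℕ => tvE s p.2 / (2 * (s : ℝ) + 1) ^ (p.1 + 2) * x ^ (p.1 + 1) *
      y ^ (p.2 + 1)) = fun p : ℕ × ℕ =>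
        x ^ (p.1 + 1) / (2 * (s : ℝ) + 1) ^ (p.1 + 2) * (tvE s p.2 * y ^ (p.2 + 1)) := by
    funext p
    simp only [div_eq_mul_inv]
    ring
  have e2 : x * y * tvP s y / ((2 * (s : ℝ) + 1) * (2 * s + 1 - x)) =
      x / ((2 * (s : ℝ) + 1) * (2 * s + 1 - x)) * (y * tvP s y) := by
    simp only [div_eq_mul_inv]
    ring
  rw [e1, e2]
  exact h3.symm

/-- Generating function for height-one multiple t-values
`H(x,y) = Σ_{i,j ≥ 1} t(i+1, {1}_(j-1)) x^i y^j`, expressed as a `₃F₂`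
hypergeometric series (Theorem `hypg32`).  Here the pair `p : ℕ × ℕ`
corresponds to `(i, j) = (p.1 + 1, p.2 + 1)`, so the exponent tuple has
first entry `i + 1 = p.1 + 2` followed by `j - 1 = p.2` ones. -/
theorem tHeightOne_genFun (x y : ℝ) (hx : |x| < 1) (hy : |y| < 1) :
    ∑' p : ℕ × ℕ,
        multT (fun s : Fin (p.2 + 1) => if s = 0 then p.1 + 2 else 1) *
          x ^ (p.1 + 1) * y ^ (p.2 + 1) =
      x * y / (1 - x) *
        ∑' s : ℕ,
          ((ascPochhammer ℝ s).eval (1 / 2 + y / 2) *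
              (ascPochhammer ℝ s).eval (1 / 2 - x / 2)) /
            ((ascPochhammer ℝ s).eval (3 / 2) *
              (ascPochhammer ℝ s).eval (3 / 2 - x / 2)) := by
  have h := Summable.tsum_comm (f := fun (p : ℕ × ℕ) (s : ℕ) =>
    tvE s p.2 / (2 * (s : ℝ) + 1) ^ (p.1 + 2) * x ^ (p.1 + 1) * y ^ (p.2 + 1))
    (tv_sum2 x y hx hy)
  have hl : ∀ p : ℕ × ℕ, multT (fun s : Fin (p.2 + 1) => if s = 0 then p.1 + 2 else 1) *
      x ^ (p.1 + 1) * y ^ (p.2 + 1) = ∑' s : ℕ,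
        tvE s p.2 / (2 * (s : ℝ) + 1) ^ (p.1 + 2) * x ^ (p.1 + 1) * y ^ (p.2 + 1) := by
    intro p
    rw [multT_eq, tsum_mul_right, tsum_mul_right]
  rw [tsum_congr hl, ← tsum_mul_left]
  refine Eq.trans h.symm ?_
  refine tsum_congr fun s => ?_
  rw [tv_poch s x y hx]
  exact tv_inner x y hx s
end

section
/- For every positive integer n, t(2n, 1) = t(2n)·log 2 − (1/2)·t(2n+1) − Σ_{i=2}^{n} t(2i−1)·t(2n−2i+2) / (2^{2i−1} − 1). -/
open Filter Topology

lemma aux_ne (a b : ℕ) : (2 * (b:ℝ) + 2) - (2 * a + 1) ≠ 0 := by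
  intro h
  have h2 : (2 * (b:ℤ) + 2) - (2 * a + 1) = 0 := by exact_mod_cast h
  omega

lemma aux_ne2 (a b : ℕ) : (2 * (b:ℝ) + 2)^2 - (2 * a + 1)^2 ≠ 0 := by
  have h1 := aux_ne a b
  have h2 : (2 * (b:ℝ) + 2) + (2 * a + 1) ≠ 0 := by positivity
  have : (2 * (b:ℝ) + 2)^2 - (2 * a + 1)^2 = ((2 * (b:ℝ) + 2) - (2 * a + 1)) * ((2 * (b:ℝ) + 2) + (2 * a + 1)) := by ring
  rw [this]; exact mul_ne_zero h1 h2

lemma aux_ident (e m : ℝ) (he : e ≠ 0) (hm : m ≠ 0) (h : e^2 - m^2 ≠ 0) (n : ℕ) (hn : 1 ≤ n) :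
    1 / m^(2*n) * (e / (e^2 - m^2) - 1 / e) =
      ∑ i ∈ Finset.Icc 2 n, (1 / m^(2*n-2*i+2)) * (1 / e^(2*i-1)) + 1 / e^(2*n-1) * (1 / (e^2-m^2)) := by
  induction n, hn using Nat.le_induction with
  | base => simp; field_simp; ring
  | succ n hn ih =>
    rw [Finset.sum_Icc_succ_top (by omega)]
    have h1 : ∑ i ∈ Finset.Icc 2 n, (1 / m^(2*(n+1)-2*i+2)) * (1 / e^(2*i-1)) =
        1 / m^2 * ∑ i ∈ Finset.Icc 2 n, (1 / m^(2*n-2*i+2)) * (1 / e^(2*i-1)) := by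
      rw [Finset.mul_sum]
      refine Finset.sum_congr rfl fun i hi => ?_
      rw [Finset.mem_Icc] at hi
      rw [show 2*(n+1)-2*i+2 = (2*n-2*i+2) + 2 by omega, pow_add]
      field_simp
    have h2 : 1 / m^(2*(n+1)) * (e / (e^2 - m^2) - 1 / e) =
      1 / m^2 * (1 / m^(2*n) * (e / (e^2 - m^2) - 1 / e)) := by
      rw [show 2*(n+1) = 2*n+2 by ring, pow_add]
      field_simp
    rw [h2, ih, h1, mul_add, add_assoc]
    congr 1
    obtain ⟨k, rfl⟩ : ∃ k, n = k + 1 := ⟨n-1, by omega⟩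
    rw [show 2*(k+1)-1 = 2*k+1 by omega, show 2*(k+1+1)-1 = 2*k+1+2 by omega,
      show 2*(k+1+1) - 2*(k+1+1) + 2 = 2 by omega, pow_add e (2*k+1) 2]
    field_simp
    ring

lemma tendsto_inv_lin (c : ℝ) : Tendsto (fun N : ℕ => 1 / (2 * (N:ℝ) + c)) atTop (𝓝 0) := by
  simp only [one_div]
  apply Tendsto.inv_tendsto_atTop
  apply tendsto_atTop_add_const_right
  exact Tendsto.const_mul_atTop (by norm_num) tendsto_natCast_atTop_atTop

lemma tendsto_G (c : ℕ) : Tendsto (fun N : ℕ => ∑ a ∈ Finset.range N,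
    (1 / (2 * (a:ℝ) + 1 + 2 * c) - 1 / (2 * (a:ℝ) + 1 - 2 * c))) atTop (𝓝 0) := by
  induction c with
  | zero => simp
  | succ c ih =>
    have h : ∀ N : ℕ, ∑ a ∈ Finset.range N,
      (1 / (2 * (a:ℝ) + 1 + 2 * (c+1:ℕ)) - 1 / (2 * (a:ℝ) + 1 - 2 * (c+1:ℕ))) =
      ∑ a ∈ Finset.range N, (1 / (2 * (a:ℝ) + 1 + 2 * c) - 1 / (2 * (a:ℝ) + 1 - 2 * c))
       + (1 / (2 * (N:ℝ) + (1 + 2 * c)) + 1 / (2 * (N:ℝ) + (-1 - 2 * c))) := by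
      intro N
      induction N with
      | zero =>
        simp
        rw [show (-1 - 2*(c:ℝ)) = -(1 + 2*c) by ring, inv_neg]; ring
      | succ N ihN =>
        rw [Finset.sum_range_succ, ihN, Finset.sum_range_succ]
        generalize Finset.sum (M := ℝ) (Finset.range N) _ = S
        push_cast
        ring_nf
    simp_rw [h]
    simpa using ih.add ((tendsto_inv_lin (1 + 2*c)).add (tendsto_inv_lin (-1 - 2*c)))

lemma tendsto_log2 : Tendsto (fun N : ℕ => (harmonic (2*N) : ℝ) - harmonic N) atTop (𝓝 (Real.log 2)) := by
  have h := Real.tendsto_harmonic_sub_log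
  have h2 : Tendsto (fun N : ℕ => 2 * N) atTop atTop :=
    tendsto_id.const_mul_atTop' (by norm_num)
  have h3 := ((h.comp h2).sub h).add_const (Real.log 2)
  simp only [sub_self, zero_add] at h3
  refine h3.congr' ?_
  filter_upwards [eventually_gt_atTop 0] with N hN
  simp only [Function.comp]
  push_cast
  rw [Real.log_mul (by norm_num) (by positivity)]
  ring

lemma tendsto_F (a : ℕ) : Tendsto (fun N : ℕ => ∑ b ∈ Finset.range N,
    ((1/2) * (1 / (2 * (b:ℝ) + 1 - 2 * a) + 1 / (2 * (b:ℝ) + 3 + 2 * a)) - 1 / (2 * (b:ℝ) + 2)))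
    atTop (𝓝 (Real.log 2 - ∑ j ∈ Finset.range a, 1 / (2 * (j:ℝ) + 1) - (1/2) * (1 / (2 * (a:ℝ) + 1)))) := by
  induction a with
  | zero =>
    have h : ∀ N : ℕ, ∑ b ∈ Finset.range N,
      ((1/2) * (1 / (2 * (b:ℝ) + 1 - 2 * (0:ℕ)) + 1 / (2 * (b:ℝ) + 3 + 2 * (0:ℕ))) - 1 / (2 * (b:ℝ) + 2)) =
      ((harmonic (2*N) : ℝ) - harmonic N) - 1/2 + (1/2) * (1 / (2 * (N:ℝ) + 1)) := by
      intro N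
      induction N with
      | zero => simp
      | succ N ih =>
        rw [Finset.sum_range_succ, ih, show 2*(N+1) = 2*N+1+1 by ring, harmonic_succ, harmonic_succ, harmonic_succ]
        push_cast
        rw [mul_zero, sub_zero, add_zero]
        field_simp
        ring
    simp_rw [h]
    have := (tendsto_log2.sub_const (1/2)).add ((tendsto_inv_lin 1).const_mul (1/2))
    simpa using this
  | succ c ih =>
    have h : ∀ N : ℕ, ∑ b ∈ Finset.range N,
      ((1/2) * (1 / (2 * (b:ℝ) + 1 - 2 * (c+1:ℕ)) + 1 / (2 * (b:ℝ) + 3 + 2 * (c+1:ℕ))) - 1 / (2 * (b:ℝ) + 2)) =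
      ∑ b ∈ Finset.range N,
      ((1/2) * (1 / (2 * (b:ℝ) + 1 - 2 * c) + 1 / (2 * (b:ℝ) + 3 + 2 * c)) - 1 / (2 * (b:ℝ) + 2))
       + ((1/2) * (1 / (2 * (N:ℝ) + (3 + 2 * c)) - 1 / (2 * (N:ℝ) + (-1 - 2 * c)))
          - (1/2) * (1 / (3 + 2 * (c:ℝ)) + 1 / (1 + 2 * c))) := by
      intro N
      induction N with
      | zero =>
        simp
        rw [show (-1 - 2*(c:ℝ)) = -(1 + 2*c) by ring, inv_neg]; ring
      | succ N ihN =>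
        rw [Finset.sum_range_succ, ihN, Finset.sum_range_succ]
        generalize Finset.sum (M := ℝ) (Finset.range N) _ = S
        push_cast
        ring_nf
    simp_rw [h]
    have := ih.add ((((tendsto_inv_lin (3 + 2*c)).sub (tendsto_inv_lin (-1 - 2*c))).const_mul (1/2)).sub_const
      ((1/2) * (1 / (3 + 2 * (c:ℝ)) + 1 / (1 + 2 * c))))
    convert this using 2
    rw [Finset.sum_range_succ]
    push_cast
    ring_nf

lemma summable_G (n : ℕ) (hn : 1 ≤ n) : Summable (fun p : ℕ × ℕ =>
    1 / (2 * (p.2:ℝ) + 2)^(2*n-1) * (1 / ((2 * (p.2:ℝ) + 2)^2 - (2 * (p.1:ℝ) + 1)^2))) := by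
  have h1 : Summable (fun b : ℕ => ((b:ℝ)+1)^(-(3/2:ℝ))) := by
    have := (summable_nat_add_iff 1).2 (Real.summable_nat_rpow.2 (by norm_num : -(3/2:ℝ) < -1))
    simpa using this
  have h2 : Summable (fun d : ℤ => |((2*d+1 : ℤ):ℝ)|^(-(3/2:ℝ))) :=
    (Real.summable_abs_int_rpow (b := 3/2) (by norm_num)).comp_injective
      (i := fun d : ℤ => 2*d+1) (fun x y h => by simpa using h)
  have h3 := h1.mul_of_nonneg h2 (fun _ => by positivity) (fun _ => by positivity)
  have h4 := h3.comp_injective (i := fun p : ℕ × ℕ => (p.2, (p.2:ℤ) - p.1))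
    (fun x y h => by
      simp only [Prod.mk.injEq] at h
      ext <;> omega)
  refine Summable.of_norm_bounded h4 ?_
  rintro ⟨a, b⟩
  simp only [Function.comp]
  set e : ℝ := 2 * (b:ℝ) + 2 with he
  set m : ℝ := 2 * (a:ℝ) + 1 with hm
  have hd : ((2 * ((b:ℤ) - a) + 1 : ℤ) : ℝ) = e - m := by push_cast; rw [he, hm]; ring
  rw [hd]
  have hne : e - m ≠ 0 := aux_ne a b
  have hd0 : 0 < |e - m| := abs_pos.2 hne
  have hb1 : (0:ℝ) < (b:ℝ) + 1 := by positivity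
  have hm0 : 0 < m := by positivity
  have he1 : (1:ℝ) ≤ e := by rw [he]; linarith [(Nat.cast_nonneg b : (0:ℝ) ≤ b)]
  have hbe : (b:ℝ) + 1 ≤ e := by rw [he]; linarith [(Nat.cast_nonneg b : (0:ℝ) ≤ b)]
  rw [show e^2 - m^2 = (e-m)*(e+m) by ring]
  rw [norm_mul, norm_div, norm_div, norm_one, norm_pow, norm_mul, Real.norm_of_nonneg (by linarith : 0 ≤ e),
    Real.norm_of_nonneg (by linarith : 0 ≤ e + m), Real.norm_eq_abs]
  rw [← Real.mul_rpow hb1.le hd0.le, Real.rpow_neg (by positivity), ← one_div_mul_one_div_rev, ← one_div, ]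
  rw [one_div_mul_one_div_rev, one_div_mul_one_div_rev]
  apply one_div_le_one_div_of_le (by positivity)
  set x := ((b:ℝ)+1) * |e-m| with hx
  have hx0 : 0 < x := by positivity
  rw [show (3/2:ℝ) = 1 + 1/2 by norm_num, Real.rpow_add hx0, Real.rpow_one, ← Real.sqrt_eq_rpow]
  have hs : √x ≤ e + m := by
    rw [Real.sqrt_le_left (by linarith)]
    have : |e-m| ≤ e+m := by rw [abs_le]; constructor <;> linarith
    rw [sq]
    exact mul_le_mul (by linarith) this hd0.le (by linarith)
  have hp : (b:ℝ)+1 ≤ e^(2*n-1) := hbe.trans (le_self_pow₀ he1 (by omega))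
  calc x * √x ≤ x * (e+m) := by gcongr
    _ ≤ (e^(2*n-1) * |e-m|) * (e+m) := by rw [hx]; gcongr
    _ = _ := by ring

lemma summable_T (s : ℕ) (hs : 2 ≤ s) : Summable (fun a : ℕ => 1 / (2 * (a:ℝ) + 1)^s) := by
  have := (Real.summable_one_div_nat_pow.2 (by omega : 1 < s)).comp_injective
    (i := fun a : ℕ => 2*a+1) (fun x y h => by simpa using h)
  simpa [Function.comp_def] using this

lemma summable_E (s : ℕ) (hs : 2 ≤ s) : Summable (fun a : ℕ => 1 / (2 * (a:ℝ) + 2)^s) := by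
  have := (Real.summable_one_div_nat_pow.2 (by omega : 1 < s)).comp_injective
    (i := fun a : ℕ => 2*a+2) (fun x y h => by simpa using h)
  simpa [Function.comp_def] using this

lemma summable_L (s t : ℕ) (hs : 2 ≤ s) (ht : 2 ≤ t) : Summable (fun p : ℕ × ℕ =>
    (1 / (2 * (p.1:ℝ) + 1)^s) * (1 / (2 * (p.2:ℝ) + 2)^t)) :=
  (summable_T s hs).mul_of_nonneg (summable_E t ht)
      (fun _ => by positivity) (fun _ => by positivity)

lemma tsum_L (s t : ℕ) (hs : 2 ≤ s) (ht : 2 ≤ t) : ∑' p : ℕ × ℕ,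
    (1 / (2 * (p.1:ℝ) + 1)^s) * (1 / (2 * (p.2:ℝ) + 2)^t) =
    (∑' a : ℕ, 1 / (2 * (a:ℝ) + 1)^s) * ∑' b : ℕ, 1 / (2 * (b:ℝ) + 2)^t :=
  ((summable_T s hs).tsum_mul_tsum (summable_E t ht) (summable_L s t hs ht)).symm

lemma E_eq (s : ℕ) (hs : 2 ≤ s) : ∑' b : ℕ, 1 / (2 * (b:ℝ) + 2)^s =
    (∑' a : ℕ, 1 / (2 * (a:ℝ) + 1)^s) / ((2:ℝ)^s - 1) := by
  have h2 : (1:ℝ) < 2^s := one_lt_pow₀ (by norm_num) (by omega)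
  have hT := summable_T s hs
  have hE := summable_E s hs
  let f : ℕ → ℝ := fun k => 1 / ((k:ℝ)+1)^s
  have e1 : (fun k => f (2*k)) = fun a : ℕ => 1 / (2 * (a:ℝ) + 1)^s := by ext k; simp [f]
  have e2 : (fun k => f (2*k+1)) = fun a : ℕ => 1 / (2 * (a:ℝ) + 2)^s := by
    ext k; simp only [f]; push_cast; ring_nf
  have key := tsum_even_add_odd (f := f) (by rw [e1]; exact hT) (by rw [e2]; exact hE)
  rw [e1, e2] at key
  have e3 : ∑' k, f k = 2^s * ∑' b : ℕ, 1 / (2 * (b:ℝ) + 2)^s := by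
    rw [← tsum_mul_left]
    congr 1; ext k
    simp only [f]
    rw [show (2 * (k:ℝ) + 2) = 2 * (k+1) by ring, mul_pow]
    field_simp
  rw [e3] at key
  rw [eq_div_iff (by linarith)]
  linarith

lemma multT_one (s : ℕ) : multT ![s] = ∑' a : ℕ, 1 / (2 * (a:ℝ) + 1)^s := by
  unfold multT
  let e : ℕ ≃ {f : Fin 1 → ℕ // StrictAnti f ∧ ∀ i, Odd (f i)} :=
    Equiv.ofBijective (fun a => ⟨fun _ => 2*a+1, Subsingleton.strictAnti _, fun _ => odd_two_mul_add_one a⟩) (by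
      constructor
      · intro x y h
        have := congrFun (congrArg Subtype.val h) 0
        simpa using this
      · rintro ⟨f, hf, ho⟩
        obtain ⟨k, hk⟩ := ho 0
        refine ⟨k, Subtype.ext (funext fun i => ?_)⟩
        rw [Subsingleton.elim i 0]; exact hk.symm)
  rw [← e.tsum_eq]
  congr 1; ext a
  have h0 : (e a).1 0 = 2*a+1 := rfl
  rw [Fin.prod_univ_one, h0]
  simp

lemma multT_pair (s : ℕ) (hs : Summable (fun a : ℕ => 1 / (2 * (a:ℝ) + 1)^s * ∑ j ∈ Finset.range a, 1 / (2 * (j:ℝ) + 1))) :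
    multT ![s, 1] = ∑' a : ℕ, 1 / (2 * (a:ℝ) + 1)^s * ∑ j ∈ Finset.range a, 1 / (2 * (j:ℝ) + 1) := by
  unfold multT
  let e : (Σ a : ℕ, Fin a) ≃ {f : Fin 2 → ℕ // StrictAnti f ∧ ∀ i, Odd (f i)} :=
    Equiv.ofBijective (fun p => ⟨![2*p.1+1, 2*p.2.1+1], by
        rw [Fin.strictAnti_iff_succ_lt]
        intro i; rw [Subsingleton.elim i 0]; simp, by
        intro i; fin_cases i <;> simp⟩) (by
      constructor
      · rintro ⟨x, x', hx⟩ ⟨y, y', hy⟩ h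
        have h0 := congrFun (congrArg Subtype.val h) 0
        have h1 := congrFun (congrArg Subtype.val h) 1
        simp at h0 h1
        subst h0; subst h1; rfl
      · rintro ⟨f, hf, ho⟩
        obtain ⟨k, hk⟩ := ho 0
        obtain ⟨l, hl⟩ := ho 1
        have hlt : f 1 < f 0 := hf (by decide)
        refine ⟨⟨k, l, by omega⟩, Subtype.ext (funext fun i => ?_)⟩
        fin_cases i
        · simp [hk]
        · simp [hl])
  rw [← e.tsum_eq]
  have e1 : ∀ p : (Σ a : ℕ, Fin a), (∏ i, 1 / (((e p).1 i : ℝ) ^ (![s, 1] i))) =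
     1 / (2 * (p.1:ℝ) + 1)^s * (1 / (2 * (p.2.1:ℝ) + 1)) := by
    intro p
    have h0 : (e p).1 0 = 2*p.1+1 := rfl
    have h1 : (e p).1 1 = 2*p.2.1+1 := rfl
    rw [Fin.prod_univ_two, h0, h1]
    simp
  simp_rw [e1]
  have e2 : ∀ a : ℕ, ∑' j : Fin a, 1 / (2 * (a:ℝ) + 1)^s * (1 / (2 * (j.1:ℝ) + 1)) =
      1 / (2 * (a:ℝ) + 1)^s * ∑ j ∈ Finset.range a, 1 / (2 * (j:ℝ) + 1) := by
    intro a
    rw [tsum_fintype, Finset.mul_sum, Finset.sum_range]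
  have hsum : Summable (fun p : (Σ a : ℕ, Fin a) => 1 / (2 * (p.1:ℝ) + 1)^s * (1 / (2 * (p.2.1:ℝ) + 1))) := by
    rw [summable_sigma_of_nonneg (fun p => by positivity)]
    refine ⟨fun a => (hasSum_fintype _).summable, ?_⟩
    simp_rw [e2]; exact hs
  rw [hsum.tsum_sigma]
  simp_rw [e2]

theorem multT_two_n_one (n : ℕ) (hn : 0 < n) :
    multT ![2 * n, 1] =
      multT ![2 * n] * Real.log 2 - (1 / 2) * multT ![2 * n + 1] -
        ∑ i ∈ Finset.Icc 2 n,
          multT ![2 * i - 1] * multT ![2 * n - 2 * i + 2] /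
            ((2 : ℝ) ^ (2 * i - 1) - 1) := by
  let G : ℕ × ℕ → ℝ := fun p =>
    1 / (2 * (p.2:ℝ) + 2)^(2*n-1) * (1 / ((2 * (p.2:ℝ) + 2)^2 - (2 * (p.1:ℝ) + 1)^2))
  let L : ℕ → ℕ × ℕ → ℝ := fun i p =>
    (1 / (2 * (p.1:ℝ) + 1)^(2*n-2*i+2)) * (1 / (2 * (p.2:ℝ) + 2)^(2*i-1))
  let F : ℕ × ℕ → ℝ := fun p => 1 / (2 * (p.1:ℝ) + 1)^(2*n) *
    ((2 * (p.2:ℝ) + 2) / ((2 * (p.2:ℝ) + 2)^2 - (2 * (p.1:ℝ) + 1)^2) - 1 / (2 * (p.2:ℝ) + 2))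
  have hG : Summable G := summable_G n hn
  have hL : ∀ i ∈ Finset.Icc 2 n, Summable (L i) := fun i hi => by
    rw [Finset.mem_Icc] at hi
    exact summable_L (2*n-2*i+2) (2*i-1) (by omega) (by omega)
  have hLt : ∀ i ∈ Finset.Icc 2 n, ∑' p, L i p = multT ![2 * i - 1] * multT ![2 * n - 2 * i + 2] /
            ((2 : ℝ) ^ (2 * i - 1) - 1) := fun i hi => by
    rw [Finset.mem_Icc] at hi
    have := tsum_L (2*n-2*i+2) (2*i-1) (by omega) (by omega)
    simp only [L]
    rw [this, E_eq _ (by omega), multT_one, multT_one]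
    ring
  have hF : F = fun p => ∑ i ∈ Finset.Icc 2 n, L i p + G p := by
    ext p
    exact aux_ident _ _ (by positivity) (by positivity) (aux_ne2 p.1 p.2) n hn
  have hsL : Summable (fun p => ∑ i ∈ Finset.Icc 2 n, L i p) := summable_sum hL
  have hsF : Summable F := by rw [hF]; exact hsL.add hG
  have hGt : ∑' p, G p = 0 := by
    rw [← (Equiv.prodComm ℕ ℕ).tsum_eq]
    have hG' := (Equiv.prodComm ℕ ℕ).summable_iff.2 hG
    rw [show (∑' c, G ((Equiv.prodComm ℕ ℕ) c)) = ∑' c, (G ∘ (Equiv.prodComm ℕ ℕ)) c from rfl, hG'.tsum_prod]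
    rw [show (0:ℝ) = ∑' b : ℕ, 0 by simp]
    congr 1; ext b
    refine tendsto_nhds_unique (hG'.prod_factor b).hasSum.tendsto_sum_nat ?_
    have := (tendsto_G (b+1)).const_mul (1 / (2 * (b:ℝ) + 2)^(2*n-1) * (1 / (2 * (2 * (b:ℝ) + 2))))
    rw [mul_zero] at this
    refine this.congr fun N => ?_
    rw [Finset.mul_sum]
    refine Finset.sum_congr rfl fun a _ => ?_
    simp only [Function.comp, Equiv.prodComm_apply, Prod.swap, G]
    rw [mul_assoc]
    congr 1
    have h1 := aux_ne a b
    have h1' : (2 * (a:ℝ) + 1) - (2 * b + 2) ≠ 0 := by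
      intro h; apply h1; linarith
    have h2 := aux_ne2 a b
    have h3 : (2 * (a:ℝ) + 1) + (2 * b + 2) ≠ 0 := by positivity
    have h4 : (2 * (b:ℝ) + 2) ≠ 0 := by positivity
    push_cast
    rw [show 2 * ((b:ℝ) + 1) = 2 * b + 2 by ring]
    generalize 2 * (b:ℝ) + 2 = e at *
    generalize 2 * (a:ℝ) + 1 = m at *
    field_simp
    ring
  have hFa : ∀ a : ℕ, ∑' b, F (a, b) = 1 / (2 * (a:ℝ) + 1)^(2*n) * Real.log 2
      - 1 / (2 * (a:ℝ) + 1)^(2*n) * ∑ j ∈ Finset.range a, 1 / (2 * (j:ℝ) + 1)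
      - (1/2) * (1 / (2 * (a:ℝ) + 1)^(2*n+1)) := by
    intro a
    refine tendsto_nhds_unique (hsF.prod_factor a).hasSum.tendsto_sum_nat ?_
    have := (tendsto_F a).const_mul (1 / (2 * (a:ℝ) + 1)^(2*n))
    have h5 : (2 * (a:ℝ) + 1) ≠ 0 := by positivity
    rw [show 1 / (2 * (a:ℝ) + 1)^(2*n) * Real.log 2
      - 1 / (2 * (a:ℝ) + 1)^(2*n) * ∑ j ∈ Finset.range a, 1 / (2 * (j:ℝ) + 1)
      - (1/2) * (1 / (2 * (a:ℝ) + 1)^(2*n+1)) = 1 / (2 * (a:ℝ) + 1)^(2*n) * (Real.log 2 - ∑ j ∈ Finset.range a, 1 / (2 * (j:ℝ) + 1) - (1/2) * (1 / (2 * (a:ℝ) + 1))) by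
        rw [pow_succ, one_div_mul_eq_div, one_div (_ * _), mul_inv]; ring]
    refine this.congr fun N => ?_
    rw [Finset.mul_sum]
    refine Finset.sum_congr rfl fun b _ => ?_
    simp only [F]
    congr 1
    have h1 := aux_ne a b
    have h2 := aux_ne2 a b
    have h3 : (2 * (b:ℝ) + 2) + (2 * a + 1) ≠ 0 := by positivity
    have h4 : (2 * (b:ℝ) + 2) ≠ 0 := by positivity
    rw [show 2 * (b:ℝ) + 1 - 2 * a = (2 * b + 2) - (2 * a + 1) by ring,
      show 2 * (b:ℝ) + 3 + 2 * a = (2 * b + 2) + (2 * a + 1) by ring]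
    generalize 2 * (b:ℝ) + 2 = e at *
    generalize 2 * (a:ℝ) + 1 = m at *
    congr 1
    field_simp
    ring
  have hs1 := (summable_T (2*n) (by omega)).mul_right (Real.log 2)
  have hs3 := (summable_T (2*n+1) (by omega)).mul_left (1/2)
  have hsFa : Summable (fun a => ∑' b, F (a, b)) := hsF.prod
  have hs2 : Summable (fun a : ℕ => 1 / (2 * (a:ℝ) + 1)^(2*n) * ∑ j ∈ Finset.range a, 1 / (2 * (j:ℝ) + 1)) := by
    refine ((hs1.sub hs3).sub hsFa).congr fun a => ?_
    rw [hFa]; ring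
  have t1 : ∑' p, F p = ∑ i ∈ Finset.Icc 2 n, multT ![2 * i - 1] * multT ![2 * n - 2 * i + 2] /
            ((2 : ℝ) ^ (2 * i - 1) - 1) := by
    rw [hF, hsL.tsum_add hG, hGt, add_zero, Summable.tsum_finsetSum hL]
    exact Finset.sum_congr rfl hLt
  have t2 : ∑' p, F p = multT ![2 * n] * Real.log 2 - multT ![2 * n, 1] - (1 / 2) * multT ![2 * n + 1] := by
    rw [hsF.tsum_prod]
    simp_rw [hFa]
    rw [(hs1.sub hs2).tsum_sub hs3, hs1.tsum_sub hs2, tsum_mul_right, tsum_mul_left, multT_pair _ hs2,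
      multT_one, multT_one]
  rw [← t1, t2]
  ring
end

section
/- For every even positive integer p, t(p+1, 1) = t(p+1)·log 2 − (1/2)·ζ(bar(p+1), 1) + [ (p+1)(1 − 2^{p+1}) − 2^{p+2} ] / [ 4(2^{p+2} − 1) ] · t(p+2) + (1/2) · Σ_{i=1}^{(p−2)/2} [ 2^{p+1} − 2^{2i+1} − 2^{p+1−2i} + 1 ] / [ (2^{2i+1} − 1)(2^{p+1−2i} − 1) ] · t(2i+1)·t(p+1−2i). -/
/-- The alternating double zeta value
`ζ(bar a, b) = Σ_{m > n ≥ 1} (−1)^m / (m^a n^b)`. -/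
noncomputable def zetaBar (a b : ℕ) : ℝ :=
  ∑' q : {q : ℕ × ℕ // q.2 < q.1 ∧ 1 ≤ q.2},
    (-1 : ℝ) ^ (q.1.1) / ((q.1.1 : ℝ) ^ a * (q.1.2 : ℝ) ^ b)


open Finset Filter Topology

lemma geomAB (a b : ℝ) (ha : a ≠ 0) (hb : b ≠ 0) (h : b ^ 2 - a ^ 2 ≠ 0) (r : ℕ) :
    ∑ k ∈ range r, (1 / a ^ (2 * k + 3)) * (1 / b ^ (2 * (r - k) + 1)) =
      1 / (a ^ (2 * r + 1) * b * (b ^ 2 - a ^ 2)) + 1 / (b ^ (2 * r + 1) * a * (a ^ 2 - b ^ 2)) := by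
  have h' : a ^ 2 - b ^ 2 ≠ 0 := by
    intro h0; apply h; linarith
  have e : a ^ 2 - b ^ 2 = -(b ^ 2 - a ^ 2) := by ring
  induction r with
  | zero =>
    rw [e]; simp only [range_zero, sum_empty]; field_simp; ring
  | succ r ih =>
    rw [sum_range_succ]
    have : ∑ k ∈ range r, (1 / a ^ (2 * k + 3)) * (1 / b ^ (2 * (r + 1 - k) + 1)) =
        (∑ k ∈ range r, (1 / a ^ (2 * k + 3)) * (1 / b ^ (2 * (r - k) + 1))) / b ^ 2 := by
      rw [sum_div]
      refine sum_congr rfl fun k hk => ?_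
      have hk := mem_range.1 hk
      have : 2 * (r + 1 - k) + 1 = 2 * (r - k) + 1 + 2 := by omega
      rw [this]
      field_simp
      ring
    rw [this, ih, e]
    have : r + 1 - r = 1 := by omega
    rw [this]
    simp only [mul_add, pow_add, pow_mul, pow_one, mul_one]
    generalize hd : b ^ 2 - a ^ 2 = d at *
    have hb2 : b ^ 2 = a ^ 2 + d := by linarith
    field_simp
    have hb3 : b ^ 3 = b * (a ^ 2 + d) := by rw [← hb2]; ring
    have hb4 : b ^ 4 = (a ^ 2 + d) ^ 2 := by rw [← hb2]; ring
    ring_nf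
    try simp only [hb2]
    try ring

noncomputable def ff (x : ℕ → ℝ) (r : ℕ) (q : ℕ × ℕ) : ℝ :=
  1 / (x q.1 ^ (2 * r + 1) * x q.2 * (x q.2 ^ 2 - x q.1 ^ 2))

lemma ff_summable (x : ℕ → ℝ) (hx : ∀ i : ℕ, (i : ℝ) + 1 ≤ x i)
    (hd : ∀ i j, i ≠ j → 1 ≤ |x j - x i|) (r : ℕ) : Summable (ff x r) := by
  have hs : Summable (fun i : ℕ => 1 / ((i : ℝ) + 1) ^ (3 / 2 : ℝ)) := by
    have := (Real.summable_one_div_nat_rpow (p := 3 / 2)).2 (by norm_num)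
    have := (summable_nat_add_iff 1).2 this
    simpa using this
  have hx1 : ∀ i, 1 ≤ x i := fun i => le_trans (by
    have : (0 : ℝ) ≤ i := Nat.cast_nonneg i
    linarith) (hx i)
  have hsx : Summable (fun i : ℕ => 1 / (x i) ^ (3 / 2 : ℝ)) := by
    refine Summable.of_nonneg_of_le (fun i => ?_) (fun i => ?_) hs
    · have := hx1 i; positivity
    · apply one_div_le_one_div_of_le (by positivity)
      exact Real.rpow_le_rpow (by positivity) (hx i) (by norm_num)
  have hp := hsx.mul_of_nonneg hsx (fun i => by have := hx1 i; simp only [Pi.zero_apply]; positivity)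
    (fun i => by have := hx1 i; simp only [Pi.zero_apply]; positivity)
  refine Summable.of_norm_bounded hp ?_
  rintro ⟨i, j⟩
  simp only [ff]
  have hi := hx1 i
  have hj := hx1 j
  by_cases hij : i = j
  · subst hij
    simp; positivity
  have h1 := hd i j hij
  have key : x i ^ (3 / 2 : ℝ) * x j ^ (3 / 2 : ℝ) ≤
      |x i ^ (2 * r + 1) * x j * (x j ^ 2 - x i ^ 2)| := by
    have e1 : ∀ y : ℝ, 1 ≤ y → y ^ (3 / 2 : ℝ) = y * √y := by
      intro y hy
      rw [Real.sqrt_eq_rpow, show (3 / 2 : ℝ) = 1 + 1 / 2 by norm_num,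
        Real.rpow_add (by linarith), Real.rpow_one]
    rw [e1 _ hi, e1 _ hj, show x j ^ 2 - x i ^ 2 = (x j + x i) * (x j - x i) by ring,
      abs_mul, abs_mul, abs_mul, abs_of_pos (show 0 < x i ^ (2 * r + 1) by positivity),
      abs_of_pos (show 0 < x j by positivity), abs_of_pos (show 0 < x j + x i by positivity)]
    have e2 : √(x i) * √(x j) ≤ x j + x i := by
      have := Real.sq_sqrt (show 0 ≤ x i by linarith)
      have := Real.sq_sqrt (show 0 ≤ x j by linarith)
      nlinarith [sq_nonneg (√(x i) - √(x j))]
    have e3 : x i ≤ x i ^ (2 * r + 1) := le_self_pow₀ hi (by omega)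
    calc x i * √(x i) * (x j * √(x j)) = x i * x j * (√(x i) * √(x j)) := by ring
      _ ≤ x i ^ (2 * r + 1) * x j * (x j + x i) := by gcongr
      _ = x i ^ (2 * r + 1) * x j * ((x j + x i) * 1) := by ring
      _ ≤ _ := by gcongr
  rw [norm_div, norm_one, Real.norm_eq_abs, one_div_mul_one_div]
  exact one_div_le_one_div_of_le (by positivity) key

lemma main_generic (x : ℕ → ℝ) (hx : ∀ i : ℕ, (i : ℝ) + 1 ≤ x i)
    (hd : ∀ i j, i ≠ j → 1 ≤ |x j - x i|) (G : ℕ → ℝ)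
    (hG : ∀ i L, HasSum (fun j : ℕ => 1 / (x j * (x j ^ 2 - x i ^ 2))) L → L = G i / x i ^ 2) (r : ℕ) :
    Summable (fun i => G i / x i ^ (2 * r + 3)) ∧
    ∑ k ∈ range r, (∑' i, 1 / x i ^ (2 * k + 3)) * (∑' i, 1 / x i ^ (2 * (r - k) + 1)) =
      2 * ∑' i, G i / x i ^ (2 * r + 3) + r * ∑' i, 1 / x i ^ (2 * r + 4) := by
  have hx1 : ∀ i, 1 ≤ x i := fun i => le_trans (by
    have : (0 : ℝ) ≤ i := Nat.cast_nonneg i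
    linarith) (hx i)
  have hS : ∀ s, 2 ≤ s → Summable (fun i => 1 / x i ^ s) := by
    intro s hs
    have h2 : Summable (fun i : ℕ => 1 / ((i : ℝ) + 1) ^ s) := by
      have := (Real.summable_one_div_nat_pow (p := s)).2 (by omega)
      have := (summable_nat_add_iff 1).2 this
      simpa using this
    refine Summable.of_nonneg_of_le (fun i => ?_) (fun i => ?_) h2
    · have := hx1 i; positivity
    · apply one_div_le_one_div_of_le (by positivity)
      exact pow_le_pow_left₀ (by positivity) (hx i) _
  have hF := ff_summable x hx hd r
  have hne : ∀ i, x i ≠ 0 := fun i => by have := hx1 i; positivity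
  have hinner : ∀ i, ∑' j, ff x r (i, j) = G i / x i ^ (2 * r + 3) := by
    intro i
    have hsi : Summable (fun j => ff x r (i, j)) := hF.prod_factor i
    have h2 := (hsi.hasSum).mul_left (x i ^ (2 * r + 1))
    have h3 := hG i (x i ^ (2 * r + 1) * ∑' j, ff x r (i, j)) (by
      have e : (fun j => 1 / (x j * (x j ^ 2 - x i ^ 2))) =
          fun j => x i ^ (2 * r + 1) * ff x r (i, j) := by
        funext j
        have := hne i
        change _ = x i ^ (2 * r + 1) * (1 / (x i ^ (2 * r + 1) * x j * (x j ^ 2 - x i ^ 2)))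
        rw [mul_assoc (x i ^ (2 * r + 1)), ← one_div_mul_one_div (x i ^ (2 * r + 1)), ← mul_assoc, mul_one_div_cancel (by positivity), one_mul]
      rw [e]
      exact h2)
    have := hne i
    field_simp at h3 ⊢
    rw [← h3]; ring
  have htot : ∑' q, ff x r q = ∑' i, G i / x i ^ (2 * r + 3) := by
    rw [hF.tsum_prod]
    exact tsum_congr hinner
  have hsum1 : Summable (fun i => G i / x i ^ (2 * r + 3)) := by
    have := hF.prod
    exact this.congr hinner
  refine ⟨hsum1, ?_⟩
  have hswap : HasSum (fun q : ℕ × ℕ => ff x r q.swap) (∑' q, ff x r q) :=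
    (Equiv.prodComm ℕ ℕ).hasSum_iff.2 hF.hasSum
  have hA := hF.hasSum.add hswap
  have hdiag : HasSum (fun q : ℕ × ℕ => if q.1 = q.2 then (r : ℝ) * (1 / x q.1 ^ (2 * r + 4)) else 0)
      (r * ∑' i, 1 / x i ^ (2 * r + 4)) := by
    have h0 := (hS (2 * r + 4) (by omega)).hasSum.mul_left (r : ℝ)
    have hinj : Function.Injective (fun i : ℕ => (i, i)) := fun a b h => by simpa using h
    refine (hinj.hasSum_iff ?_).1 ?_
    · rintro ⟨a, b⟩ hab
      have : a ≠ b := by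
        rintro rfl; exact hab ⟨a, rfl⟩
      simp [this]
    · simpa [Function.comp_def] using h0
  have hB := hA.add hdiag
  have hC : HasSum (fun q : ℕ × ℕ => ∑ k ∈ range r,
      (1 / x q.1 ^ (2 * k + 3)) * (1 / x q.2 ^ (2 * (r - k) + 1)))
      (∑ k ∈ range r, (∑' i, 1 / x i ^ (2 * k + 3)) * (∑' i, 1 / x i ^ (2 * (r - k) + 1))) := by
    refine hasSum_sum fun k hk => ?_
    have hk := mem_range.1 hk
    have s1 := hS (2 * k + 3) (by omega)
    have s2 := hS (2 * (r - k) + 1) (by omega)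
    have nn : ∀ s, (0 : ℕ → ℝ) ≤ fun i => 1 / x i ^ s := fun s i => by
      have := hx1 i; simp only [Pi.zero_apply]; positivity
    have hpr := s1.mul_of_nonneg s2 (nn (2 * k + 3)) (nn (2 * (r - k) + 1))
    have hh0 := s1.hasSum.mul s2.hasSum hpr
    exact hh0
  have := hC.unique (by
    convert hB using 1
    funext ⟨i, j⟩
    simp only [ff, Prod.swap]
    by_cases hij : i = j
    · subst hij
      simp only [sub_self, mul_zero, div_zero, if_true, zero_add]
      rw [sum_congr rfl (g := fun _ => 1 / x i ^ (2 * r + 4))]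
      · simp
      · intro k hk
        have hk := mem_range.1 hk
        rw [one_div_mul_one_div, ← pow_add]
        congr 2; omega
    · rw [if_neg hij, add_zero]
      refine geomAB _ _ (hne i) (hne j) ?_ r
      have h1 := hd i j hij
      have hi := hx1 i
      have hj := hx1 j
      rw [show x j ^ 2 - x i ^ 2 = (x j + x i) * (x j - x i) by ring]
      refine mul_ne_zero (by positivity) ?_
      intro h; rw [h] at h1; norm_num at h1)
  rw [this, htot]; ring

noncomputable def hh (n : ℕ) : ℝ := ∑ i ∈ range n, 1 / ((i : ℝ) + 1)

lemma hh_eq (n : ℕ) : hh n = (harmonic n : ℝ) := by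
  simp [hh, harmonic]

lemma hh_succ (n : ℕ) : hh (n + 1) = hh n + 1 / ((n : ℝ) + 1) := by
  simp [hh, sum_range_succ]

lemma hh_shift (c : ℕ) : Tendsto (fun n => hh (n + c) - hh n) atTop (𝓝 0) := by
  induction c with
  | zero => simp
  | succ c ih =>
    have h1 : Tendsto (fun n : ℕ => 1 / ((((n + c : ℕ)) : ℝ) + 1)) atTop (𝓝 0) :=
      (tendsto_one_div_add_atTop_nhds_zero_nat (𝕜 := ℝ)).comp (tendsto_add_atTop_nat c)
    have := ih.add h1
    rw [add_zero] at this
    refine this.congr fun n => ?_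
    rw [← add_assoc, hh_succ]; ring

lemma hh_double : Tendsto (fun n => hh (2 * n) - hh n) atTop (𝓝 (Real.log 2)) := by
  have h := Real.tendsto_harmonic_sub_log
  have h2 : Tendsto (fun n : ℕ => 2 * n) atTop atTop :=
    tendsto_id.const_mul_atTop' (by norm_num)
  have h3 := ((h.comp h2).sub h).add_const (Real.log 2)
  rw [sub_self, zero_add] at h3
  refine h3.congr' ?_
  filter_upwards [eventually_gt_atTop 0] with n hn
  have : (n : ℝ) ≠ 0 := by positivity
  simp only [Function.comp, hh_eq, Nat.cast_mul, Nat.cast_ofNat]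
  rw [Real.log_mul (by norm_num) this]; ring

lemma hh_odd (n : ℕ) : ∑ j ∈ range n, 1 / (2 * (j : ℝ) + 1) = hh (2 * n) - hh n / 2 := by
  induction n with
  | zero => simp [hh]
  | succ n ih =>
    rw [sum_range_succ, ih, show 2 * (n + 1) = 2 * n + 1 + 1 by ring, hh_succ, hh_succ, hh_succ]
    push_cast
    have : 2 * (n : ℝ) + 1 ≠ 0 := by positivity
    have : (n : ℝ) + 1 ≠ 0 := by positivity
    have : 2 * (n : ℝ) + 1 + 1 ≠ 0 := by positivity
    field_simp
    ring

/-- reflected harmonic sum -/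
lemma hh_neg (i : ℕ) : ∑ j ∈ range i, 1 / ((j : ℝ) - i) = - hh i := by
  rw [← sum_range_reflect, hh, ← sum_neg_distrib]
  refine sum_congr rfl fun j hj => ?_
  have hj := mem_range.1 hj
  rw [show i - 1 - j = i - (j + 1) by omega, Nat.cast_sub (by omega), ← one_div_neg_eq_neg_one_div]
  congr 1; push_cast; ring

lemma hh_mid (i M : ℕ) : ∑ j ∈ range (M + (i + 1)), 1 / ((j : ℝ) - i) = hh M - hh i := by
  induction M with
  | zero => rw [zero_add, sum_range_succ, hh_neg]; simp [hh]
  | succ M ih =>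
    rw [show M + 1 + (i + 1) = M + (i + 1) + 1 by ring, sum_range_succ, ih, hh_succ]
    push_cast
    rw [show (M : ℝ) + (i + 1) - i = M + 1 by ring]; ring

lemma hh_up (c N : ℕ) : ∑ j ∈ range N, 1 / ((j : ℝ) + c + 1) = hh (N + c) - hh c := by
  induction N with
  | zero => simp
  | succ M ih =>
    rw [sum_range_succ, ih, show M + 1 + c = M + c + 1 by ring, hh_succ]
    push_cast; ring

lemma inner_zeta (i : ℕ) (L : ℝ)
    (h : HasSum (fun j : ℕ => 1 / (((j : ℝ) + 1) * (((j : ℝ) + 1) ^ 2 - ((i : ℝ) + 1) ^ 2))) L) :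
    L = (- hh i + 1 / (4 * ((i : ℝ) + 1))) / ((i : ℝ) + 1) ^ 2 := by
  have hi : (i : ℝ) + 1 ≠ 0 := by positivity
  rw [eq_div_iff (by positivity)]
  have h1 := (h.mul_right (((i : ℝ) + 1) ^ 2)).tendsto_sum_nat.comp (tendsto_add_atTop_nat (i + 1))
  refine tendsto_nhds_unique h1 ?_
  have hterm : ∀ j : ℕ, 1 / (((j : ℝ) + 1) * (((j : ℝ) + 1) ^ 2 - ((i : ℝ) + 1) ^ 2)) *
      ((i : ℝ) + 1) ^ 2 = (1 / 2) * (1 / ((j : ℝ) - i)) + (1 / 2) * (1 / ((j : ℝ) + (i + 1 : ℕ) + 1))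
        - 1 / ((j : ℝ) + 1) + if j = i then 3 / (4 * ((i : ℝ) + 1)) else 0 := by
    intro j
    have hj : (j : ℝ) + 1 ≠ 0 := by positivity
    have h3 : (j : ℝ) + (i + 1 : ℕ) + 1 ≠ 0 := by positivity
    by_cases hji : j = i
    · subst hji
      push_cast at h3 ⊢
      simp only [sub_self, mul_zero, div_zero, zero_mul, if_true]
      field_simp; ring
    · rw [if_neg hji, show ((j : ℝ) + 1) ^ 2 - ((i : ℝ) + 1) ^ 2 =
        ((j : ℝ) - i) * ((j : ℝ) + (i + 1 : ℕ) + 1) by push_cast; ring]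
      have : (j : ℝ) - i ≠ 0 := sub_ne_zero.2 (by exact_mod_cast hji)
      field_simp; push_cast; ring
  have hps : ∀ M : ℕ, ∑ j ∈ range (M + (i + 1)),
      1 / (((j : ℝ) + 1) * (((j : ℝ) + 1) ^ 2 - ((i : ℝ) + 1) ^ 2)) * ((i : ℝ) + 1) ^ 2 =
      (1 / 2) * (hh (M + (2 * i + 2)) - hh M) - (hh (M + (i + 1)) - hh M)
        + (- hh i + 1 / (4 * ((i : ℝ) + 1))) := by
    intro M
    simp only [hterm]
    rw [sum_add_distrib, sum_sub_distrib, sum_add_distrib, ← mul_sum, ← mul_sum, hh_mid, hh_up,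
      sum_ite_eq' , if_pos (mem_range.2 (by omega)), hh_succ i, ← hh,
      show M + (i + 1) + (i + 1) = M + (2 * i + 2) by ring]
    field_simp; ring
  have hl := (((hh_shift (2 * i + 2)).const_mul (1 / 2)).sub (hh_shift (i + 1))).add_const
    (- hh i + 1 / (4 * ((i : ℝ) + 1)))
  rw [mul_zero, sub_zero, zero_add] at hl
  exact hl.congr fun M => (hps M).symm

lemma inner_t (i : ℕ) (L : ℝ)
    (h : HasSum (fun j : ℕ => 1 / ((2 * (j : ℝ) + 1) * ((2 * (j : ℝ) + 1) ^ 2 - (2 * (i : ℝ) + 1) ^ 2))) L) :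
    L = (- hh i / 2 + 3 / (4 * (2 * (i : ℝ) + 1)) - Real.log 2) / (2 * (i : ℝ) + 1) ^ 2 := by
  have hi : 2 * (i : ℝ) + 1 ≠ 0 := by positivity
  rw [eq_div_iff (by positivity)]
  have h1 := (h.mul_right ((2 * (i : ℝ) + 1) ^ 2)).tendsto_sum_nat.comp (tendsto_add_atTop_nat (i + 1))
  refine tendsto_nhds_unique h1 ?_
  have hterm : ∀ j : ℕ, 1 / ((2 * (j : ℝ) + 1) * ((2 * (j : ℝ) + 1) ^ 2 - (2 * (i : ℝ) + 1) ^ 2)) *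
      (2 * (i : ℝ) + 1) ^ 2 = (1 / 4) * (1 / ((j : ℝ) - i)) + (1 / 4) * (1 / ((j : ℝ) + i + 1))
        - 1 / (2 * (j : ℝ) + 1) + if j = i then 3 / (4 * (2 * (i : ℝ) + 1)) else 0 := by
    intro j
    have hj : 2 * (j : ℝ) + 1 ≠ 0 := by positivity
    have h3 : (j : ℝ) + i + 1 ≠ 0 := by positivity
    by_cases hji : j = i
    · subst hji
      simp only [sub_self, mul_zero, div_zero, zero_mul, if_true]
      rw [show (j : ℝ) + j + 1 = 2 * j + 1 by ring]
      field_simp; ring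
    · rw [if_neg hji, show (2 * (j : ℝ) + 1) ^ 2 - (2 * (i : ℝ) + 1) ^ 2 =
        4 * ((j : ℝ) - i) * ((j : ℝ) + i + 1) by ring]
      have : (j : ℝ) - i ≠ 0 := sub_ne_zero.2 (by exact_mod_cast hji)
      field_simp; ring
  have hps : ∀ M : ℕ, ∑ j ∈ range (M + (i + 1)),
      1 / ((2 * (j : ℝ) + 1) * ((2 * (j : ℝ) + 1) ^ 2 - (2 * (i : ℝ) + 1) ^ 2)) * (2 * (i : ℝ) + 1) ^ 2 =
      (1 / 4) * (hh (M + (2 * i + 1)) - hh M) - (1 / 2) * (hh (M + (i + 1)) - hh M)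
        - (hh (2 * (M + (i + 1))) - hh (M + (i + 1)))
        + (- hh i / 2 + 3 / (4 * (2 * (i : ℝ) + 1))) := by
    intro M
    simp only [hterm]
    rw [sum_add_distrib, sum_sub_distrib, sum_add_distrib, ← mul_sum, ← mul_sum, hh_mid, hh_up,
      sum_ite_eq' , if_pos (mem_range.2 (by omega)), hh_odd,
      show M + (i + 1) + i = M + (2 * i + 1) by ring]
    ring
  have hl := ((((hh_shift (2 * i + 1)).const_mul (1 / 4)).sub
    ((hh_shift (i + 1)).const_mul (1 / 2))).sub (hh_double.comp (tendsto_add_atTop_nat (i + 1)))).add_const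
    (- hh i / 2 + 3 / (4 * (2 * (i : ℝ) + 1)))
  refine Tendsto.congr (fun M => (hps M).symm) ?_
  have e : - hh i / 2 + 3 / (4 * (2 * (i : ℝ) + 1)) - Real.log 2 =
      1 / 4 * 0 - 1 / 2 * 0 - Real.log 2 + (- hh i / 2 + 3 / (4 * (2 * (i : ℝ) + 1))) := by ring
  rw [e]
  exact hl

noncomputable def zz (s : ℕ) : ℝ := ∑' i : ℕ, 1 / ((i : ℝ) + 1) ^ s
noncomputable def tt (s : ℕ) : ℝ := ∑' i : ℕ, 1 / (2 * (i : ℝ) + 1) ^ s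

lemma zz_summable (s : ℕ) (hs : 2 ≤ s) : Summable (fun i : ℕ => 1 / ((i : ℝ) + 1) ^ s) := by
  have := (Real.summable_one_div_nat_pow (p := s)).2 (by omega)
  have := (summable_nat_add_iff 1).2 this
  simpa using this

lemma tt_summable (s : ℕ) (hs : 2 ≤ s) : Summable (fun i : ℕ => 1 / (2 * (i : ℝ) + 1) ^ s) := by
  have := (zz_summable s hs).comp_injective (i := fun k : ℕ => 2 * k) (fun a b h => by simpa using h)
  simpa [Function.comp_def] using this

lemma tt_zz (s : ℕ) (hs : 2 ≤ s) : tt s = (1 - 1 / 2 ^ s) * zz s := by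
  have h1 := tt_summable s hs
  have h2 := zz_summable s hs
  have h3 : ∀ k : ℕ, 1 / (((2 * k + 1 : ℕ) : ℝ) + 1) ^ s = (1 / 2 ^ s) * (1 / ((k : ℝ) + 1) ^ s) := by
    intro k
    rw [one_div_mul_one_div, ← mul_pow]; push_cast; congr 2; ring
  have h := tsum_even_add_odd (f := fun i : ℕ => 1 / ((i : ℝ) + 1) ^ s)
    (by simpa using h1) (by simp only [h3]; exact h2.mul_left _)
  simp only [h3] at h
  rw [tsum_mul_left] at h
  have h4 : ∑' k : ℕ, 1 / (((2 * k : ℕ) : ℝ) + 1) ^ s = tt s := by simp [tt]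
  rw [h4] at h
  change tt s + 1 / 2 ^ s * zz s = zz s at h
  linarith

lemma zeta_rel (r : ℕ) :
    Summable (fun i : ℕ => hh i / ((i : ℝ) + 1) ^ (2 * r + 3)) ∧
    ∑ k ∈ range r, zz (2 * k + 3) * zz (2 * (r - k) + 1) =
      -2 * ∑' i : ℕ, hh i / ((i : ℝ) + 1) ^ (2 * r + 3) + (r + 1 / 2) * zz (2 * r + 4) := by
  obtain ⟨h1, h2⟩ := main_generic (fun i : ℕ => (i : ℝ) + 1) (fun i => le_rfl) (by
    intro i j hij
    have : (1 : ℤ) ≤ |(j : ℤ) - i| := Int.one_le_abs (by omega)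
    rw [add_sub_add_right_eq_sub]
    exact_mod_cast this) _ inner_zeta r
  have hz := zz_summable (2 * r + 4) (by omega)
  have e : ∀ i : ℕ, hh i / ((i : ℝ) + 1) ^ (2 * r + 3) = (1 / 4) * (1 / ((i : ℝ) + 1) ^ (2 * r + 4)) -
      (- hh i + 1 / (4 * ((i : ℝ) + 1))) / ((i : ℝ) + 1) ^ (2 * r + 3) := by
    intro i
    have hi : (i : ℝ) + 1 ≠ 0 := by positivity
    rw [pow_succ _ (2 * r + 3)]
    field_simp; ring
  refine ⟨((hz.mul_left (1 / 4)).sub h1).congr fun i => (e i).symm, ?_⟩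
  rw [tsum_congr e, Summable.tsum_sub (hz.mul_left _) h1, tsum_mul_left]
  change _ = _ + (r : ℝ) * zz (2 * r + 4) at h2
  change _ = -2 * (1 / 4 * zz (2 * r + 4) - _) + _
  simp only [zz] at h2 ⊢
  rw [h2]; ring

lemma t_rel (r : ℕ) :
    Summable (fun i : ℕ => hh i / (2 * (i : ℝ) + 1) ^ (2 * r + 3)) ∧
    ∑ k ∈ range r, tt (2 * k + 3) * tt (2 * (r - k) + 1) =
      - ∑' i : ℕ, hh i / (2 * (i : ℝ) + 1) ^ (2 * r + 3) + (r + 3 / 2) * tt (2 * r + 4)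
      - 2 * Real.log 2 * tt (2 * r + 3) := by
  obtain ⟨h1, h2⟩ := main_generic (fun i : ℕ => 2 * (i : ℝ) + 1) (fun i => by
      have : (0 : ℝ) ≤ i := Nat.cast_nonneg i
      linarith) (by
    intro i j hij
    have : (1 : ℤ) ≤ |2 * (j : ℤ) - 2 * i| := Int.one_le_abs (by omega)
    rw [add_sub_add_right_eq_sub]
    exact_mod_cast this) _ inner_t r
  have hz := tt_summable (2 * r + 4) (by omega)
  have hy := tt_summable (2 * r + 3) (by omega)
  have e : ∀ i : ℕ, hh i / (2 * (i : ℝ) + 1) ^ (2 * r + 3) =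
      (3 / 2) * (1 / (2 * (i : ℝ) + 1) ^ (2 * r + 4)) -
      (2 * Real.log 2) * (1 / (2 * (i : ℝ) + 1) ^ (2 * r + 3)) -
      2 * ((- hh i / 2 + 3 / (4 * (2 * (i : ℝ) + 1)) - Real.log 2) / (2 * (i : ℝ) + 1) ^ (2 * r + 3)) := by
    intro i
    have hi : 2 * (i : ℝ) + 1 ≠ 0 := by positivity
    rw [pow_succ _ (2 * r + 3)]
    field_simp; ring
  refine ⟨(((hz.mul_left (3 / 2)).sub (hy.mul_left (2 * Real.log 2))).sub (h1.mul_left 2)).congr fun i => (e i).symm, ?_⟩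
  rw [tsum_congr e, Summable.tsum_sub ((hz.mul_left _).sub (hy.mul_left _)) (h1.mul_left _),
    Summable.tsum_sub (hz.mul_left _) (hy.mul_left _), tsum_mul_left, tsum_mul_left, tsum_mul_left]
  simp only [tt] at h2 ⊢
  rw [h2]; ring

lemma multT_one_s18 (s : ℕ) : multT ![s] = tt s := by
  unfold multT tt
  let g : ℕ → {f : Fin 1 → ℕ // StrictAnti f ∧ ∀ i, Odd (f i)} := fun k =>
    ⟨fun _ => 2 * k + 1, Subsingleton.strictAnti _, fun _ => ⟨k, rfl⟩⟩
  have hg : Function.Bijective g := by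
    constructor
    · intro a b h
      have := congrFun (congrArg Subtype.val h) 0
      simp only [g] at this
      omega
    · rintro ⟨f, h1, h2⟩
      obtain ⟨k, hk⟩ := h2 0
      refine ⟨k, Subtype.ext (funext fun i => ?_)⟩
      rw [Subsingleton.elim i 0]; exact hk.symm
  rw [← (Equiv.ofBijective g hg).tsum_eq]
  refine tsum_congr fun k => ?_
  simp [g]

/-- triangular sums -/
lemma tri (u v : ℕ → ℝ) (hs : Summable (fun q : ℕ × ℕ => if q.2 < q.1 then u q.1 * v q.2 else 0)) :
    ∑' q : {q : ℕ × ℕ // q.2 < q.1}, u q.1.1 * v q.1.2 = ∑' i, u i * ∑ j ∈ range i, v j := by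
  have h := tsum_subtype {q : ℕ × ℕ | q.2 < q.1} (fun q => u q.1 * v q.2)
  refine Eq.trans h ?_
  have e : Set.indicator {q : ℕ × ℕ | q.2 < q.1} (fun q => u q.1 * v q.2) =
      fun q : ℕ × ℕ => if q.2 < q.1 then u q.1 * v q.2 else 0 := by
    funext q; simp [Set.indicator]
  rw [e, hs.tsum_prod]
  refine tsum_congr fun i => ?_
  rw [tsum_eq_sum (s := range i), mul_sum]
  · exact sum_congr rfl fun j hj => by simp [mem_range.1 hj]
  · intro j hj
    have : ¬ j < i := by simpa using hj
    simp [this]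

lemma tri_summable (u v : ℕ → ℝ) (s : ℕ) (hs : 3 ≤ s) (hu : ∀ i, |u i| ≤ 1 / ((i : ℝ) + 1) ^ s)
    (hv : ∀ i, |v i| ≤ 1 / ((i : ℝ) + 1)) :
    Summable (fun q : ℕ × ℕ => if q.2 < q.1 then u q.1 * v q.2 else 0) := by
  have h2 := zz_summable 2 le_rfl
  have hp := h2.mul_of_nonneg h2 (fun i => by simp only [Pi.zero_apply]; positivity)
    (fun i => by simp only [Pi.zero_apply]; positivity)
  refine Summable.of_norm_bounded hp ?_
  rintro ⟨i, j⟩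
  simp only
  split_ifs with hij
  · rw [Real.norm_eq_abs, abs_mul]
    have hij' : (j : ℝ) + 1 ≤ i + 1 := by
      have : (j : ℝ) ≤ i := by exact_mod_cast hij.le
      linarith
    have hi1 : (1 : ℝ) ≤ (i : ℝ) + 1 := by
      have : (0 : ℝ) ≤ i := Nat.cast_nonneg i
      linarith
    calc |u i| * |v j| ≤ (1 / ((i : ℝ) + 1) ^ s) * (1 / ((j : ℝ) + 1)) := by
          gcongr
          · exact hu i
          · exact hv j
      _ ≤ (1 / ((i : ℝ) + 1) ^ 3) * (1 / ((j : ℝ) + 1)) := by gcongr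
      _ ≤ _ := by
        rw [one_div_mul_one_div, one_div_mul_one_div]
        apply one_div_le_one_div_of_le (by positivity)
        calc ((i : ℝ) + 1) ^ 2 * ((j : ℝ) + 1) ^ 2 = ((i : ℝ) + 1) ^ 2 * ((j : ℝ) + 1) * ((j : ℝ) + 1) := by ring
          _ ≤ ((i : ℝ) + 1) ^ 2 * ((j : ℝ) + 1) * ((i : ℝ) + 1) := by gcongr
          _ = _ := by ring
  · simp; positivity

lemma multT_two (s : ℕ) (hs : 3 ≤ s) :
    multT ![s, 1] = ∑' i : ℕ, (hh (2 * i) - hh i / 2) / (2 * (i : ℝ) + 1) ^ s := by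
  have h := tri (fun i : ℕ => 1 / (2 * (i : ℝ) + 1) ^ s) (fun j : ℕ => 1 / (2 * (j : ℝ) + 1))
    (tri_summable (fun i : ℕ => 1 / (2 * (i : ℝ) + 1) ^ s) (fun j : ℕ => 1 / (2 * (j : ℝ) + 1)) s hs (fun i => by
      rw [abs_of_nonneg (by positivity)]
      gcongr
      have : (0 : ℝ) ≤ i := Nat.cast_nonneg i
      linarith) (fun i => by
      rw [abs_of_nonneg (by positivity)]
      gcongr
      have : (0 : ℝ) ≤ i := Nat.cast_nonneg i
      linarith))
  simp only [hh_odd] at h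
  have e : ∀ i : ℕ, (hh (2 * i) - hh i / 2) / (2 * (i : ℝ) + 1) ^ s =
    1 / (2 * (i : ℝ) + 1) ^ s * (hh (2 * i) - hh i / 2) := fun i => by ring
  rw [tsum_congr e, ← h]
  unfold multT
  let g : {q : ℕ × ℕ // q.2 < q.1} → {f : Fin 2 → ℕ // StrictAnti f ∧ ∀ i, Odd (f i)} := fun q =>
    ⟨![2 * q.1.1 + 1, 2 * q.1.2 + 1], by
      refine Fin.strictAnti_iff_succ_lt.2 fun i => ?_
      have := q.2
      fin_cases i
      simpa using this, by
      intro i; fin_cases i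
      · exact ⟨_, rfl⟩
      · exact ⟨_, rfl⟩⟩
  have hg : Function.Bijective g := by
    constructor
    · rintro ⟨⟨a, b⟩, h⟩ ⟨⟨c, d⟩, h'⟩ hh
      have h0 := congrFun (congrArg Subtype.val hh) 0
      have h1 := congrFun (congrArg Subtype.val hh) 1
      simp [g] at h0 h1
      subst h0 h1; rfl
    · rintro ⟨f, h1, h2⟩
      obtain ⟨k, hk⟩ := h2 0
      obtain ⟨l, hl⟩ := h2 1
      have h3 : f 1 < f 0 := h1 (by simp)
      refine ⟨⟨(k, l), by simp only; omega⟩, Subtype.ext (funext fun i => ?_)⟩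
      fin_cases i
      · simp [g, hk]
      · simp [g, hl]
  rw [← (Equiv.ofBijective g hg).tsum_eq]
  refine tsum_congr fun k => ?_
  simp [g, Fin.prod_univ_two]
  ring

lemma zetaBar_one (s : ℕ) (hs : 3 ≤ s) :
    zetaBar s 1 = ∑' i : ℕ, (-1) ^ (i + 1) * (hh i / ((i : ℝ) + 1) ^ s) := by
  have h := tri (fun i : ℕ => (-1) ^ (i + 1) / ((i : ℝ) + 1) ^ s) (fun j : ℕ => 1 / ((j : ℝ) + 1))
    (tri_summable (fun i : ℕ => (-1) ^ (i + 1) / ((i : ℝ) + 1) ^ s) (fun j : ℕ => 1 / ((j : ℝ) + 1)) s hs (fun i => by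
      rw [abs_div, abs_pow, abs_neg, abs_one, one_pow, abs_of_nonneg (by positivity)]) (fun i => by
      rw [abs_of_nonneg (by positivity)]))
  have hdef : ∀ i, ∑ j ∈ range i, 1 / ((j : ℝ) + 1) = hh i := fun i => rfl
  simp only [hdef] at h
  have e : ∀ i : ℕ, (-1) ^ (i + 1) * (hh i / ((i : ℝ) + 1) ^ s) =
    (-1) ^ (i + 1) / ((i : ℝ) + 1) ^ s * hh i := fun i => by ring
  rw [tsum_congr e, ← h]
  unfold zetaBar
  let g : {q : ℕ × ℕ // q.2 < q.1} → {q : ℕ × ℕ // q.2 < q.1 ∧ 1 ≤ q.2} := fun q =>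
    ⟨(q.1.1 + 1, q.1.2 + 1), by have := q.2; simp only; omega⟩
  have hg : Function.Bijective g := by
    constructor
    · rintro ⟨⟨a, b⟩, h⟩ ⟨⟨c, d⟩, h'⟩ hh
      simp [g] at hh
      obtain ⟨rfl, rfl⟩ := hh
      rfl
    · rintro ⟨⟨a, b⟩, h1, h2⟩
      simp only at h1 h2
      refine ⟨⟨(a - 1, b - 1), by simp only; omega⟩, Subtype.ext ?_⟩
      simp only [g, Prod.mk.injEq]
      omega
  rw [← (Equiv.ofBijective g hg).tsum_eq]
  refine tsum_congr fun k => ?_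
  simp [g]
  field_simp

lemma split_rel (r : ℕ) :
    multT ![2 * r + 3, 1] = (1 / 2) * ∑' i : ℕ, hh i / ((i : ℝ) + 1) ^ (2 * r + 3)
      - (1 / 2) * zetaBar (2 * r + 3) 1
      - (1 / 2) * ∑' i : ℕ, hh i / (2 * (i : ℝ) + 1) ^ (2 * r + 3) := by
  have hz := (zeta_rel r).1
  have ht := (t_rel r).1
  rw [multT_two _ (by omega), zetaBar_one _ (by omega)]
  set w : ℕ → ℝ := fun i => hh i / ((i : ℝ) + 1) ^ (2 * r + 3) with hw
  have he : Summable (fun k : ℕ => w (2 * k)) :=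
    hz.comp_injective (i := fun k : ℕ => 2 * k) (fun a b h => by simpa using h)
  have ho : Summable (fun k : ℕ => w (2 * k + 1)) :=
    hz.comp_injective (i := fun k : ℕ => 2 * k + 1) (fun a b h => by simpa using h)
  have h1 := tsum_even_add_odd he ho
  have e1 : ∀ k : ℕ, (-1 : ℝ) ^ (2 * k + 1) * w (2 * k) = - w (2 * k) := fun k => by
    rw [pow_succ, pow_mul]; simp
  have e2 : ∀ k : ℕ, (-1 : ℝ) ^ (2 * k + 1 + 1) * w (2 * k + 1) = w (2 * k + 1) := fun k => by
    rw [pow_succ, pow_succ, pow_mul]; simp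
  have h2 := tsum_even_add_odd (f := fun i => (-1 : ℝ) ^ (i + 1) * w i)
    (by simp only [e1]; exact he.neg) (by simp only [e2]; exact ho)
  simp only [e1, e2] at h2
  rw [tsum_neg] at h2
  have e3 : ∀ i : ℕ, (hh (2 * i) - hh i / 2) / (2 * (i : ℝ) + 1) ^ (2 * r + 3) =
      w (2 * i) - (1 / 2) * (hh i / (2 * (i : ℝ) + 1) ^ (2 * r + 3)) := fun i => by
    simp only [hw]; push_cast; ring
  rw [tsum_congr e3, Summable.tsum_sub he (ht.mul_left _), tsum_mul_left]
  change _ = 1 / 2 * ∑' i, w i - 1 / 2 * ∑' i, (-1 : ℝ) ^ (i + 1) * w i - _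
  rw [← h1, ← h2]; ring

/-- Evaluation of `t(p+1, 1)` for even positive `p` (Theorem `evenp1`). -/
theorem multT_even_p_one (p : ℕ) (hp : 0 < p) (hpe : Even p) :
    multT ![p + 1, 1] =
      multT ![p + 1] * Real.log 2 - (1 / 2) * zetaBar (p + 1) 1 +
        (((p : ℝ) + 1) * (1 - 2 ^ (p + 1)) - 2 ^ (p + 2)) /
            (4 * ((2 : ℝ) ^ (p + 2) - 1)) * multT ![p + 2] +
        (1 / 2) *
          ∑ i ∈ Finset.Icc 1 ((p - 2) / 2),
            ((2 : ℝ) ^ (p + 1) - 2 ^ (2 * i + 1) - 2 ^ (p + 1 - 2 * i) + 1) /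
                (((2 : ℝ) ^ (2 * i + 1) - 1) * ((2 : ℝ) ^ (p + 1 - 2 * i) - 1)) *
              (multT ![2 * i + 1] * multT ![p + 1 - 2 * i]) := by
  obtain ⟨r, rfl⟩ : ∃ r, p = 2 * r + 2 := by
    obtain ⟨k, hk⟩ := hpe
    exact ⟨k - 1, by omega⟩
  have hz := (zeta_rel r).2
  have ht := (t_rel r).2
  have hs := split_rel r
  simp only [multT_one_s18]
  have hsum : ∑ i ∈ Finset.Icc 1 ((2 * r + 2 - 2) / 2),
            ((2 : ℝ) ^ (2 * r + 2 + 1) - 2 ^ (2 * i + 1) - 2 ^ (2 * r + 2 + 1 - 2 * i) + 1) /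
                (((2 : ℝ) ^ (2 * i + 1) - 1) * ((2 : ℝ) ^ (2 * r + 2 + 1 - 2 * i) - 1)) *
              (tt (2 * i + 1) * tt (2 * r + 2 + 1 - 2 * i)) =
      ∑ k ∈ range r, tt (2 * k + 3) * tt (2 * (r - k) + 1)
        - (1 / 2) * ∑ k ∈ range r, zz (2 * k + 3) * zz (2 * (r - k) + 1) := by
    rw [mul_sum, ← sum_sub_distrib]
    have : (2 * r + 2 - 2) / 2 = r := by omega
    rw [this, ← Finset.Ico_add_one_right_eq_Icc, Finset.sum_Ico_eq_sum_range]
    refine sum_congr (by simp) fun k hk => ?_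
    have hk := mem_range.1 hk
    have e1 : 2 * (1 + k) + 1 = 2 * k + 3 := by ring
    have e2 : 2 * r + 2 + 1 - 2 * (1 + k) = 2 * (r - k) + 1 := by omega
    have e3 : (2 : ℝ) ^ (2 * r + 2 + 1) = 2 ^ (2 * k + 3) * 2 ^ (2 * (r - k) + 1) / 2 := by
      rw [← pow_add, show 2 * k + 3 + (2 * (r - k) + 1) = 2 * r + 2 + 1 + 1 by omega, pow_succ _ (2 * r + 2 + 1)]
      ring
    rw [e1, e2, e3, tt_zz _ (by omega), tt_zz _ (by omega)]
    have hA : (1 : ℝ) < 2 ^ (2 * k + 3) := one_lt_pow₀ (by norm_num) (by omega)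
    have hB : (1 : ℝ) < 2 ^ (2 * (r - k) + 1) := one_lt_pow₀ (by norm_num) (by omega)
    generalize (2 : ℝ) ^ (2 * k + 3) = A at *
    generalize (2 : ℝ) ^ (2 * (r - k) + 1) = B at *
    have : A - 1 ≠ 0 := by linarith
    have : B - 1 ≠ 0 := by linarith
    have : A ≠ 0 := by linarith
    have : B ≠ 0 := by linarith
    field_simp
    ring
  rw [hsum, ht, hz]
  rw [show 2 * r + 2 + 1 = 2 * r + 3 by ring, show 2 * r + 2 + 2 = 2 * r + 4 by ring, hs,
    tt_zz (2 * r + 4) (by omega)]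
  have hA : (1 : ℝ) < 2 ^ (2 * r + 4) := one_lt_pow₀ (by norm_num) (by omega)
  have hB : (2 : ℝ) ^ (2 * r + 3) = 2 ^ (2 * r + 4) / 2 := by rw [pow_succ _ (2 * r + 3)]; ring
  rw [hB]
  generalize (2 : ℝ) ^ (2 * r + 4) = A at *
  have : A - 1 ≠ 0 := by linarith
  have : A ≠ 0 := by linarith
  push_cast
  field_simp
  ring
end
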